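/- For the walk driven by the negative discrete second derivative −Δ/2 of its local time, define for x ≥ 0 the hitting time τ_x = inf{n ≥ 0 : X_n = x}. Then with positive probability, τ_x < ∞ for every x ≥ 0 and τ_x / x² → 1/2 as x → ∞. -/

import Mathlib

open MeasureTheory Real Filter Set

noncomputable section

/-- Number of crossings of the edge `{e, e+1}` (i.e. the half-integer edge `e + 1/2`)
before time `n`. -/
def locTime {Ω : Type*} (X : ℕ → Ω → ℤ) (n : ℕ) (e : ℤ) (ω : Ω) : ℕ :=
  ((Finset.range n).filter fun m => min (X m ω) (X (m + 1) ω) = e).card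

/-- Local time profile seen from the walker: `ℓ_n(k + 1/2)`. -/
def shiftedProfile {Ω : Type*} (X : ℕ → Ω → ℤ) (n : ℕ) (k : ℤ) (ω : Ω) : ℕ :=
  locTime X n (X n ω + k) ω

/-- `F(y) = e^y / (e^y + e^{-y})`. -/
def walkF (y : ℝ) : ℝ := Real.exp y / (Real.exp y + Real.exp (-y))

/-- The σ-algebra generated by `X_0, …, X_n`. -/
def walkFiltration {Ω : Type*} (X : ℕ → Ω → ℤ) (n : ℕ) : MeasurableSpace Ω :=
  ⨆ m ∈ Finset.range (n + 1), MeasurableSpace.comap (X m) inferInstance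

/-- The discrete second derivative of the local time profile seen from the walker:
`Δ(ℓ_n) = ℓ_n(-3/2) - ℓ_n(-1/2) - ℓ_n(1/2) + ℓ_n(3/2)`. -/
def Δ {Ω : Type*} (X : ℕ → Ω → ℤ) (n : ℕ) (ω : Ω) : ℝ :=
  (shiftedProfile X n (-2) ω : ℝ) - shiftedProfile X n (-1) ω
    - shiftedProfile X n 0 ω + shiftedProfile X n 1 ω

theorem sigmoid_le_exp (y : ℝ) : sigmoid y ≤ exp y := by
  rw [sigmoid_def, exp_neg]
  have := exp_pos y
  rw [inv_le_comm₀ (by positivity) this]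
  linarith [inv_pos.2 this]

theorem sigmoid_mul_one_sub_le (y : ℝ) :
    sigmoid y * (1 - sigmoid y) ≤ 2 * (sigmoid y - sigmoid (y - 2)) := by
  have h : exp (-(y - 2)) = exp 2 * exp (-y) := by rw [← exp_add]; ring_nf
  have h2 : 2 ≤ exp 2 := by linarith [add_one_le_exp (2 : ℝ)]
  rw [sigmoid_def, sigmoid_def, h]
  generalize exp 2 = r at *
  have ha := exp_pos (-y)
  generalize exp (-y) = a at *
  have e1 : (1 + a)⁻¹ * (1 - (1 + a)⁻¹) = a / (1 + a) ^ 2 := by field_simp; ring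
  have e2 : 2 * ((1 + a)⁻¹ - (1 + r * a)⁻¹) = 2 * (r - 1) * a / ((1 + a) * (1 + r * a)) := by
    have : 1 + r * a ≠ 0 := by positivity
    field_simp; ring
  rw [e1, e2, div_le_div_iff₀ (by positivity) (by positivity)]
  have : 0 ≤ a * (1 + a) * (2 * (r - 1) * (1 + a) - (1 + r * a)) := by
    apply mul_nonneg (by positivity)
    nlinarith
  nlinarith

/-- The sum of the logistic function along the progression `y, y - 2, y - 4, …`. -/
def sigmoidSum (y : ℝ) : ℝ := ∑' k : ℕ, sigmoid (y - 2 * k)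

theorem hasSum_exp_sub (y : ℝ) :
    HasSum (fun k : ℕ => exp (y - 2 * k)) (exp y * (1 - exp (-2))⁻¹) := by
  have h1 : exp (-2 : ℝ) < 1 := by rw [exp_lt_one_iff]; norm_num
  have h2 : (fun k : ℕ => exp (y - 2 * k)) = fun k : ℕ => exp y * exp (-2) ^ k := by
    funext k
    rw [← exp_nat_mul, ← exp_add]; ring_nf
  rw [h2]
  exact (hasSum_geometric_of_lt_one (exp_pos (-2)).le h1).mul_left (exp y)

theorem summable_sigmoid_sub (y : ℝ) : Summable fun k : ℕ => sigmoid (y - 2 * k) :=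
  (hasSum_exp_sub y).summable.of_nonneg_of_le (fun _ => (sigmoid_pos _).le)
    fun _ => sigmoid_le_exp _

theorem sigmoidSum_nonneg (y : ℝ) : 0 ≤ sigmoidSum y :=
  tsum_nonneg fun _ => (sigmoid_pos _).le

theorem sigmoidSum_le_exp (y : ℝ) : sigmoidSum y ≤ 2 * exp y := by
  have h := (summable_sigmoid_sub y).tsum_le_tsum (fun k => sigmoid_le_exp _)
    (hasSum_exp_sub y).summable
  rw [(hasSum_exp_sub y).tsum_eq] at h
  have h2 : exp (-2 : ℝ) ≤ 1 / 2 := by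
    rw [exp_neg, inv_le_comm₀ (exp_pos _) (by norm_num)]
    linarith [add_one_le_exp (2 : ℝ)]
  have h3 : (1 - exp (-2 : ℝ))⁻¹ ≤ 2 := by
    rw [inv_le_comm₀ (by linarith) (by norm_num)]; linarith
  have := mul_le_mul_of_nonneg_left h3 (exp_pos y).le
  unfold sigmoidSum; linarith

theorem sigmoidSum_eq (y : ℝ) : sigmoidSum y = sigmoid y + sigmoidSum (y - 2) := by
  unfold sigmoidSum
  rw [(summable_sigmoid_sub y).tsum_eq_zero_add]
  congr 1
  · simp
  · refine tsum_congr fun k => ?_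
    push_cast; ring_nf

theorem sigmoidSum_mono : Monotone sigmoidSum := fun a b hab =>
  (summable_sigmoid_sub a).tsum_le_tsum (fun _ => sigmoid_monotone (by linarith))
    (summable_sigmoid_sub b)

theorem sigmoidSum_reflect (m : ℤ) :
    sigmoidSum (2 * m) = m + 1 / 2 + sigmoidSum (-(2 * m) - 2) := by
  have key : ∀ y : ℝ, sigmoidSum y - sigmoidSum (-y - 2) =
      sigmoidSum (y - 2) - sigmoidSum (-(y - 2) - 2) + 1 := by
    intro y
    have h1 := sigmoidSum_eq y
    have h2 := sigmoidSum_eq (-(y - 2) - 2)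
    rw [show -(y - 2) - 2 = -y by ring] at h2 ⊢
    have h3 := sigmoid_neg y
    linarith
  induction m using Int.induction_on with
  | zero =>
    have h1 := sigmoidSum_eq 0
    have h2 : sigmoid 0 = 1 / 2 := by simp
    simp only [Int.cast_zero, mul_zero, neg_zero, zero_sub] at h1 ⊢
    linarith
  | succ i ih =>
    have := key (2 * ((i : ℤ) + 1 : ℤ))
    push_cast at this ih ⊢
    rw [show 2 * ((i : ℝ) + 1) - 2 = 2 * i by ring] at this
    linarith
  | pred i ih =>
    have := key (2 * (-(i : ℤ) : ℤ))
    push_cast at this ih ⊢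
    rw [show 2 * (-(i : ℝ)) - 2 = 2 * (-i - 1) by ring] at this
    linarith

theorem sigmoidSum_le {y t : ℝ} (hy : y ≤ t) (ht : 0 ≤ t) : sigmoidSum y ≤ t / 2 + 4 := by
  have h1 : t / 2 ≤ ⌈t / 2⌉ := Int.le_ceil _
  have h2 : (⌈t / 2⌉ : ℝ) < t / 2 + 1 := Int.ceil_lt_add_one _
  have h3 := sigmoidSum_mono (show y ≤ 2 * (⌈t / 2⌉ : ℝ) by linarith)
  have h4 := sigmoidSum_reflect ⌈t / 2⌉
  have h5 := sigmoidSum_le_exp (-(2 * (⌈t / 2⌉ : ℝ)) - 2)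
  have h6 : exp (-(2 * (⌈t / 2⌉ : ℝ)) - 2) ≤ 1 := by rw [exp_le_one_iff]; linarith
  linarith

/-- The state of a walk confined to its running maximum `top` and the two sites below it: the
walker sits at `top - pos`, and `E`, `D`, `C`, `B` are the local times of the last four edges below
`top`, from right to left. -/
structure FrontState where
  pos : ℕ
  top : ℤ
  B : ℤ
  C : ℤ
  D : ℤ
  E : ℤ

namespace FrontState

/-- The state after one more step; the flag tells whether the step is to the right. A step to the
left from `top - 2` leaves the three sites, so that its value here is irrelevant. -/
def next (st : FrontState) (right : Bool) : FrontState :=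
  match st.pos, right with
  | 0, true => ⟨0, st.top + 1, st.C, st.D, st.E, 1⟩
  | 0, false => ⟨1, st.top, st.B, st.C, st.D, st.E + 1⟩
  | 1, true => ⟨0, st.top, st.B, st.C, st.D, st.E + 1⟩
  | 1, false => ⟨2, st.top, st.B, st.C, st.D + 1, st.E⟩
  | _, _ => ⟨1, st.top, st.B, st.C, st.D + 1, st.E⟩

/-- The value of `Δ` at the walker. -/
def delta (st : FrontState) : ℤ :=
  match st.pos with
  | 0 => st.D - st.E
  | 1 => st.C - st.D - st.E
  | _ => st.B - st.C - st.D + st.E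

/-- `D`, including the pending return when the walker is at `top - 2`. -/
def Dhat (st : FrontState) : ℤ := st.D + if st.pos = 2 then 1 else 0

/-- `E`, including the pending return when the walker is at `top`. -/
def Ehat (st : FrontState) : ℤ := st.E + if st.pos = 0 then 1 else 0

/-- `E`, including the pending return when the walker is below `top`. -/
def Echk (st : FrontState) : ℤ := st.E + if st.pos = 0 then 0 else 1

/-- An approximate martingale, up to the compensated number of left steps. -/
def pot (st : FrontState) : ℝ :=
  st.Dhat / 2 + sigmoidSum (st.C - st.Dhat - st.Ehat) + sigmoidSum (st.Echk - st.Dhat - 2)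
    - st.top / 2

/-- A function whose decrease dominates the conditional variances. -/
def varPot (st : FrontState) : ℝ :=
  2 * sigmoid (st.C - st.Dhat - st.Ehat) + 2 * sigmoid (st.Dhat - st.Echk) - 5 * st.top

/-- Neighbouring local times behind the front differ by at most `T + 2`. -/
structure Tame (T : ℝ) (st : FrontState) : Prop where
  pos_le : st.pos ≤ 2
  one_le_E : 1 ≤ st.E
  abs_B_sub_C : |(st.B : ℝ) - st.C| ≤ T + 2
  abs_C_sub_D : |(st.C : ℝ) - st.Dhat| ≤ T + 2
  Echk_le : (st.Echk : ℝ) ≤ st.Dhat + T + 2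
  le_of_pos : st.pos = 2 → -T - 1 ≤ (st.C : ℝ) - st.D - st.E
  parity_D : st.Dhat % 2 = 1
  parity_E : st.Echk % 2 = 1

/-- The step encoded by `right` is not one against a drift stronger than `T`. -/
def Unsurprising (T : ℝ) (st : FrontState) (right : Bool) : Prop :=
  (T ≤ st.delta → right = false) ∧ ((st.delta : ℝ) ≤ -T → right = true)

variable {T : ℝ} {st : FrontState} {r : Bool}

theorem Tame.right_of_pos (h : st.Tame T) (hD : 8 * T + 20 ≤ st.Dhat) (hT : 0 ≤ T)
    (hr : st.Unsurprising T r) (hp : st.pos = 2) : r = true := by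
  obtain ⟨p, M, B, C, D, E⟩ := st
  obtain ⟨-, h1, h2, h3, h4, h5, -, -⟩ := h
  simp only at hp
  subst hp
  simp only [Dhat, Echk, abs_le, forall_const, if_true, Int.cast_add, Int.cast_one,
    Unsurprising, delta, Int.cast_sub] at *
  apply hr.2
  linarith

theorem Tame.next {T' : ℝ} (h : st.Tame T) (hD : 8 * T + 20 ≤ st.Dhat) (hT : 0 ≤ T) (hTT : T ≤ T')
    (hr : st.Unsurprising T r) : (st.next r).Tame T' := by
  have h2 := h.right_of_pos hD hT hr
  obtain ⟨p, M, B, C, D, E⟩ := st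
  obtain ⟨hp, h1, hBC, hCD, hED, hlow, pD, pE⟩ := h
  simp only at hp
  have h1' : (1 : ℝ) ≤ E := by exact_mod_cast h1
  interval_cases p <;> rcases r <;>
    simp [Dhat, Echk, abs_le, Unsurprising, delta] at * <;>
    constructor <;> simp [FrontState.next, Dhat, Echk, abs_le] <;>
    first
    | omega
    | (constructor <;> linarith)
    | linarith
  
theorem abs_pot_next_sub (h : st.Tame T) (hD : 8 * T + 20 ≤ st.Dhat) (hT : 0 ≤ T)
    (hr : st.Unsurprising T r) :
    |(st.next r).pot - st.pot - ((if r then 0 else 1) - sigmoid st.delta)| ≤ 2 * exp (-T) := by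
  have h2 := h.right_of_pos hD hT hr
  obtain ⟨p, M, B, C, D, E⟩ := st
  obtain ⟨hp, h1, hBC, hCD, hED, hlow, pD, pE⟩ := h
  have hexp := exp_pos (-T)
  have small : ∀ y : ℝ, y ≤ -T → sigmoidSum y ≤ 2 * exp (-T) := fun y hy =>
    (sigmoidSum_le_exp y).trans (by gcongr)
  have small' : ∀ y : ℝ, y ≤ -T → sigmoid y ≤ exp (-T) := fun y hy =>
    (sigmoid_le_exp y).trans (by gcongr)
  have h1' : (1 : ℝ) ≤ E := by exact_mod_cast h1
  simp only at hp
  interval_cases p <;> rcases r <;>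
    simp [Dhat, Echk, abs_le, Unsurprising, delta] at * <;>
    simp [FrontState.next, pot, Dhat, Ehat, Echk]
  · have := sigmoidSum_eq ((E : ℝ) - D)
    have h3 := sigmoid_neg ((D : ℝ) - E)
    rw [neg_sub] at h3
    rw [show (E : ℝ) + 1 + 1 - D - 2 = E - D by ring,
      show (C : ℝ) - D - (E + 1) = C - D - (E + 1) by ring]
    constructor <;> linarith
  · obtain ⟨m, hm⟩ : ∃ m, D - E = 2 * m := ⟨(D - E) / 2, by omega⟩
    have hm' : (D : ℝ) - E = 2 * m := by exact_mod_cast hm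
    have e1 := sigmoidSum_eq ((D : ℝ) - E)
    have e2 := sigmoidSum_reflect m
    rw [← hm', show -((D : ℝ) - E) - 2 = E - D - 2 by ring] at e2
    have e3 := sigmoidSum_nonneg (1 - (E : ℝ) - 2)
    have e4 := sigmoidSum_nonneg ((C : ℝ) - D - (E + 1))
    have e5 := small (1 - (E : ℝ) - 2) (by linarith)
    have e6 := small ((C : ℝ) - D - (E + 1)) (by linarith)
    constructor <;> linarith
  · have e1 := sigmoidSum_eq ((C : ℝ) - D - E)
    have e2 := sigmoidSum_eq ((E : ℝ) + 1 - D - 2)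
    have e3 := small' ((E : ℝ) + 1 - D - 2) (by linarith)
    have e4 := sigmoid_pos ((E : ℝ) + 1 - D - 2)
    rw [show (C : ℝ) - (D + 1 + 1) - E = C - D - E - 2 by ring,
      show (E : ℝ) - (D + 1) - 2 = E + 1 - D - 2 - 2 by ring]
    constructor <;> linarith
  · have e1 := sigmoidSum_eq ((C : ℝ) - D - E)
    rw [show (C : ℝ) - D - (E + 1 + 1) = C - D - E - 2 by ring]
    constructor <;> linarith
  · have e3 := small' ((B : ℝ) - C - D + E) (by linarith)
    have e4 := sigmoid_pos ((B : ℝ) - C - D + E)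
    constructor <;> linarith

theorem varPot_next_le (h : st.Tame T) (hD : 8 * T + 20 ≤ st.Dhat) (hT : 0 ≤ T)
    (hr : st.Unsurprising T r) :
    sigmoid st.delta * (1 - sigmoid st.delta) + (st.next r).varPot ≤ st.varPot + 2 * exp (-T) := by
  have h2 := h.right_of_pos hD hT hr
  obtain ⟨p, M, B, C, D, E⟩ := st
  obtain ⟨hp, h1, hBC, hCD, hED, hlow, pD, pE⟩ := h
  have hexp := exp_pos (-T)
  have small' : ∀ y : ℝ, y ≤ -T → sigmoid y ≤ exp (-T) := fun y hy =>
    (sigmoid_le_exp y).trans (by gcongr)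
  simp only at hp
  interval_cases p <;> rcases r <;>
    simp [Dhat, Echk, abs_le, Unsurprising, delta] at * <;>
    simp [FrontState.next, varPot, Dhat, Ehat, Echk]
  · have := sigmoid_mul_one_sub_le ((D : ℝ) - E)
    rw [show (D : ℝ) - (E + 1 + 1) = D - E - 2 by ring]
    linarith
  · have h1 := sigmoid_pos ((D : ℝ) - E)
    have h2 := sigmoid_lt_one ((D : ℝ) - E)
    have h3 := sigmoid_lt_one ((D : ℝ) - E - 2)
    have h4 := sigmoid_lt_one ((E : ℝ) - 1)
    have h5 := sigmoid_pos ((C : ℝ) - D - (E + 1))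
    nlinarith
  · have e1 := sigmoid_mul_one_sub_le ((C : ℝ) - D - E)
    have e2 := sigmoid_lt_one ((D : ℝ) + 1 - E)
    have e3 := small' (-((D : ℝ) - (E + 1))) (by linarith)
    rw [sigmoid_neg] at e3
    rw [show (C : ℝ) - (D + 1 + 1) - E = C - D - E - 2 by ring]
    linarith
  · have e1 := sigmoid_mul_one_sub_le ((C : ℝ) - D - E)
    rw [show (C : ℝ) - D - (E + 1 + 1) = C - D - E - 2 by ring]
    linarith
  · have e3 := small' ((B : ℝ) - C - D + E) (by linarith)
    have e4 := sigmoid_pos ((B : ℝ) - C - D + E)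
    nlinarith

end FrontState

/-- The local time of a deterministic path. -/
def pathLoc (x : ℕ → ℤ) (n : ℕ) (e : ℤ) : ℕ :=
  ((Finset.range n).filter fun m => min (x m) (x (m + 1)) = e).card

/-- The discrete second derivative of the local time of a deterministic path, at the walker. -/
def pathDelta (x : ℕ → ℤ) (n : ℕ) : ℝ :=
  (pathLoc x n (x n + -2) : ℝ) - pathLoc x n (x n + -1) - pathLoc x n (x n + 0)
    + pathLoc x n (x n + 1)

theorem pathLoc_succ (x : ℕ → ℤ) (n : ℕ) (e : ℤ) :
    pathLoc x (n + 1) e = pathLoc x n e + if min (x n) (x (n + 1)) = e then 1 else 0 := by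
  unfold pathLoc
  rw [Finset.range_add_one, Finset.filter_insert]
  split_ifs with h
  · rw [Finset.card_insert_of_notMem (by simp)]
  · simp

/-- A nearest-neighbour path started at `0` visits every site between `0` and its maximum. -/
theorem exists_le_eq_of_le {x : ℕ → ℤ} (h0 : x 0 = 0) (hs : ∀ n, |x (n + 1) - x n| = 1)
    {a : ℤ} (ha : 0 ≤ a) {k : ℕ} (hk : a ≤ x k) : ∃ j ≤ k, x j = a := by
  induction k with
  | zero => exact ⟨0, le_rfl, by omega⟩
  | succ k ih =>
    by_cases h : a ≤ x k
    · obtain ⟨j, hj, e⟩ := ih h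
      exact ⟨j, by omega, e⟩
    · have := (abs_eq (by norm_num)).1 (hs k)
      exact ⟨k + 1, le_rfl, by omega⟩

/-- The state `st` describes the path `x` at time `k`. -/
structure FrontState.Tracks (st : FrontState) (x : ℕ → ℤ) (k : ℕ) : Prop where
  pos_le : st.pos ≤ 2
  three_le : 3 ≤ st.top
  apply_eq : x k = st.top - st.pos
  loc_E : ∀ e, e = st.top - 1 → (pathLoc x k e : ℤ) = st.E
  loc_D : ∀ e, e = st.top - 2 → (pathLoc x k e : ℤ) = st.D
  loc_C : ∀ e, e = st.top - 3 → (pathLoc x k e : ℤ) = st.C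
  loc_B : ∀ e, e = st.top - 4 → (pathLoc x k e : ℤ) = st.B
  loc_of_le : ∀ e, st.top ≤ e → pathLoc x k e = 0
  loc_of_neg : ∀ e < 0, pathLoc x k e = 0
  le_top : ∀ t ≤ k, x t ≤ st.top
  exists_eq_top : ∃ t ≤ k, x t = st.top

namespace FrontState

variable {st : FrontState} {x : ℕ → ℤ} {k : ℕ}

theorem Tracks.pathDelta_eq (h : st.Tracks x k) : pathDelta x k = st.delta := by
  obtain ⟨p, M, B, C, D, E⟩ := st
  obtain ⟨hp, -, hx, hE, hD, hC, hB, hM, -, -, -⟩ := h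
  simp only at hp hx hE hD hC hB hM
  have e : ∀ a : ℤ, (pathLoc x k a : ℝ) = ((pathLoc x k a : ℤ) : ℝ) := fun a => by simp
  unfold pathDelta
  rw [e, e, e, e, hx]
  interval_cases p <;> simp only [delta]
  · rw [hD _ (by omega), hE _ (by omega), hM _ (by omega), hM _ (by omega)]
    simp
  · rw [hC _ (by omega), hD _ (by omega), hE _ (by omega), hM _ (by omega)]
    simp
  · rw [hB _ (by omega), hC _ (by omega), hD _ (by omega), hE _ (by omega)]
    simp

theorem Tracks.next (h : st.Tracks x k) (hs : |x (k + 1) - x k| = 1)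
    (h2 : st.pos = 2 → x (k + 1) = x k + 1) :
    (st.next (decide (x (k + 1) = x k + 1))).Tracks x (k + 1) := by
  obtain ⟨p, M, B, C, D, E⟩ := st
  obtain ⟨hp, h3, hx, hE, hD, hC, hB, hM, hlo, hle, t, ht, htM⟩ := h
  simp only at hp h3 hx hE hD hC hB hM hle htM h2
  have hs' := (abs_eq (by norm_num)).1 hs
  have hcases : x (k + 1) = x k + 1 ∨ (x (k + 1) = x k - 1 ∧ ¬ x (k + 1) = x k + 1) := by omega
  have hle' : ∀ M', M ≤ M' → x (k + 1) ≤ M' → ∀ t ≤ k + 1, x t ≤ M' := by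
    intro M' h1 h2 t ht
    rcases Nat.le_succ_iff.1 ht with h | h
    · exact (hle t h).trans h1
    · rw [h]; exact h2
  have hL : ∀ e, (pathLoc x (k + 1) e : ℤ) =
      pathLoc x k e + if min (x k) (x (k + 1)) = e then 1 else 0 := fun e => by
    rw [pathLoc_succ]; push_cast; rfl
  have hdec : decide (x (k + 1) = x k + 1) = true ∧ x (k + 1) = x k + 1 ∨
      decide (x (k + 1) = x k + 1) = false ∧ x (k + 1) = x k - 1 := by
    rcases hcases with h | ⟨h, h'⟩
    · exact Or.inl ⟨decide_eq_true h, h⟩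
    · exact Or.inr ⟨decide_eq_false h', h⟩
  clear hcases
  interval_cases p <;> rcases hdec with ⟨hd, hr⟩ | ⟨hd, hr⟩ <;>
    first
    | (exfalso; have := h2 rfl; omega)
    | skip
  all_goals
    rw [hd]
    clear hd h2 hs'
    simp only [FrontState.next]
    refine ⟨?_, ?_, ?_, fun e he => ?_, fun e he => ?_, fun e he => ?_, fun e he => ?_,
      fun e he => ?_, fun e he => ?_, hle' _ ?_ ?_, ?_⟩
    all_goals
      first
      | (have a1 := hE e
         have a2 := hD e
         have a3 := hC e
         have a4 := hB e
         have a5 := hM e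
         have a6 := hlo e
         have a7 := hL e
         clear hE hD hC hB hM hlo hL hle hle'
         try simp only at he ⊢
         split_ifs at a7 <;> omega)
      | ((try simp only); omega)
      | exact ⟨t, by omega, htM⟩
      | exact ⟨k + 1, le_rfl, by simp only; omega⟩

theorem Tracks.pathLoc_succ_of_lt (h : st.Tracks x k) (hs : |x (k + 1) - x k| = 1)
    (h2 : st.pos = 2 → x (k + 1) = x k + 1) {e : ℤ} (he : e < st.top - 2) :
    pathLoc x (k + 1) e = pathLoc x k e := by
  have h1 := (abs_eq (by norm_num)).1 hs
  have h3 := h.apply_eq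
  have h4 := h.pos_le
  rw [pathLoc_succ, if_neg, add_zero]
  omega

theorem Tracks.time_eq (h : st.Tracks x k) :
    (k : ℤ) = ∑ e ∈ Finset.Ico 0 st.top, (pathLoc x k e : ℤ) := by
  have := Finset.card_eq_sum_card_fiberwise (s := Finset.range k) (t := Finset.Ico 0 st.top)
    (f := fun m => min (x m) (x (m + 1))) fun m hm => by
      have hpos : pathLoc x k (min (x m) (x (m + 1))) ≠ 0 :=
        have h1 : m ∈ (Finset.range k).filter fun m' =>
            min (x m') (x (m' + 1)) = min (x m) (x (m + 1)) :=
          Finset.mem_filter.2 ⟨Finset.mem_coe.1 hm, rfl⟩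
        (Finset.card_pos.2 ⟨m, h1⟩).ne'
      rw [Finset.mem_coe, Finset.mem_Ico]
      constructor <;> by_contra! hc
      · exact hpos (h.loc_of_neg _ hc)
      · exact hpos (h.loc_of_le _ hc)
  rw [Finset.card_range] at this
  nth_rw 1 [this]
  push_cast
  rfl

end FrontState

/-- The compensated number of steps that are not to the right, in `i` steps from time `n`. -/
def compSum (x : ℕ → ℤ) (n i : ℕ) : ℝ :=
  ∑ m ∈ Finset.range i,
    ((if x (n + m + 1) = x (n + m) + 1 then 0 else 1) - sigmoid (pathDelta x (n + m)))

/-- The sum of the conditional variances of the terms of `compSum`. -/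
def varSum (x : ℕ → ℤ) (n i : ℕ) : ℝ :=
  ∑ m ∈ Finset.range i,
    sigmoid (pathDelta x (n + m)) * (1 - sigmoid (pathDelta x (n + m)))

/-- A path which crosses each of the edges to the right of `0` exactly `2 * N + 1` times before
it moves on to the next one. -/
def combPath (N t : ℕ) : ℤ := (t / (2 * N + 1) + t % (2 * N + 1) % 2 : ℕ)

/-- The time at which `combPath N` reaches `N + 1`. -/
def combTime (N : ℕ) : ℕ := N * (2 * N + 1) + 1

/-- The state of `combPath N` when it reaches `N + 1`. -/
def combState (N : ℕ) : FrontState := ⟨0, N + 1, 2 * N + 1, 2 * N + 1, 2 * N + 1, 1⟩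

theorem combPath_zero (N : ℕ) : combPath N 0 = 0 := by simp [combPath]

theorem combPath_eq (N q r : ℕ) (hr : r ≤ 2 * N) :
    combPath N (q * (2 * N + 1) + r) = q + (r % 2 : ℕ) := by
  unfold combPath
  rw [add_comm (q * _), Nat.add_mul_div_right _ _ (by omega), Nat.add_mul_mod_self_right,
    Nat.mod_eq_of_lt (a := r) (by omega), Nat.div_eq_of_lt (by omega)]
  push_cast
  ring

theorem combPath_cases (N t : ℕ) :
    ∃ q r : ℕ, t = q * (2 * N + 1) + r ∧ r ≤ 2 * N ∧ combPath N t = q + (r % 2 : ℕ) ∧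
      combPath N (t + 1) = q + ((r + 1) % 2 : ℕ) := by
  have h1 : t = t / (2 * N + 1) * (2 * N + 1) + t % (2 * N + 1) := by
    rw [mul_comm]; exact (Nat.div_add_mod _ _).symm
  have h2 : t % (2 * N + 1) < 2 * N + 1 := Nat.mod_lt _ (by omega)
  generalize t / (2 * N + 1) = q at h1
  generalize t % (2 * N + 1) = r at h1 h2
  refine ⟨q, r, h1, by omega, ?_, ?_⟩
  · rw [h1, combPath_eq _ _ _ (by omega)]
  · rcases Nat.lt_succ_iff_lt_or_eq.1 h2 with h | h
    · rw [h1, add_assoc, combPath_eq _ _ _ (by omega)]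
    · have : t + 1 = (q + 1) * (2 * N + 1) + 0 := by rw [h1, h]; ring
      rw [this, combPath_eq _ _ _ (by omega), h]
      have : (2 * N + 1) % 2 = 1 := by omega
      rw [this]
      push_cast
      ring

theorem abs_combPath_succ_sub (N t : ℕ) : |combPath N (t + 1) - combPath N t| = 1 := by
  obtain ⟨q, r, -, -, h1, h2⟩ := combPath_cases N t
  rw [h1, h2, abs_eq (by norm_num)]
  omega

theorem min_combPath (N t : ℕ) :
    min (combPath N t) (combPath N (t + 1)) = (t / (2 * N + 1) : ℕ) := by
  obtain ⟨q, r, h0, hr, h1, h2⟩ := combPath_cases N t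
  rw [h1, h2, h0, add_comm (q * _), Nat.add_mul_div_right _ _ (by omega),
    Nat.div_eq_of_lt (by omega)]
  omega

theorem pathLoc_combPath_of_lt (N : ℕ) {e : ℤ} (he : 0 ≤ e) (heN : e < N) :
    pathLoc (combPath N) (combTime N) e = 2 * N + 1 := by
  obtain ⟨e, rfl⟩ := Int.eq_ofNat_of_zero_le he
  have heN' : e + 1 ≤ N := by omega
  have h : ((Finset.range (combTime N)).filter fun m =>
      min (combPath N m) (combPath N (m + 1)) = (e : ℤ)) =
      Finset.Ico (e * (2 * N + 1)) ((e + 1) * (2 * N + 1)) := by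
    ext m
    have h3 : (e + 1) * (2 * N + 1) ≤ N * (2 * N + 1) := Nat.mul_le_mul_right _ heN'
    rw [Finset.mem_filter, Finset.mem_range, min_combPath, Nat.cast_inj,
      Nat.div_eq_iff (by omega), Finset.mem_Ico, combTime]
    rw [add_mul] at *
    omega
  rw [pathLoc, h, Nat.card_Ico, add_mul]
  omega

theorem pathLoc_combPath_self (N : ℕ) : pathLoc (combPath N) (combTime N) N = 1 := by
  rw [combTime, pathLoc_succ, min_combPath, Nat.mul_div_cancel _ (by omega), if_pos rfl,
    Nat.add_eq_right, pathLoc, Finset.card_eq_zero, Finset.filter_eq_empty_iff]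
  intro m hm
  rw [min_combPath, Nat.cast_inj]
  exact (Nat.div_lt_of_lt_mul (by rw [mul_comm]; exact Finset.mem_range.1 hm)).ne

theorem pathLoc_combPath_of_notMem (N : ℕ) {e : ℤ} (he : e < 0 ∨ N < e) :
    pathLoc (combPath N) (combTime N) e = 0 := by
  rw [pathLoc, Finset.card_eq_zero, Finset.filter_eq_empty_iff]
  intro m hm
  rw [min_combPath]
  have : m / (2 * N + 1) ≤ N := by
    rw [Finset.mem_range, combTime] at hm
    refine (Nat.div_le_div_right (Nat.lt_succ_iff.1 hm)).trans ?_
    rw [Nat.mul_div_cancel _ (by omega)]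
  generalize m / (2 * N + 1) = a at this
  omega

theorem combPath_combTime (N : ℕ) : combPath N (combTime N) = N + 1 := by
  have h := combPath_eq N N 1
  rcases Nat.eq_zero_or_pos N with rfl | hN
  · simp [combPath, combTime]
  · rw [combTime, h (by omega)]; simp

theorem combPath_le {N t : ℕ} (ht : t ≤ combTime N) : combPath N t ≤ N + 1 := by
  rcases Nat.lt_or_ge t (combTime N) with h | h
  · have : t / (2 * N + 1) ≤ N := by
      rw [combTime] at h
      refine (Nat.div_le_div_right (Nat.lt_succ_iff.1 h)).trans ?_
      rw [Nat.mul_div_cancel _ (by omega)]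
    unfold combPath
    omega
  · rw [le_antisymm ht h, combPath_combTime]

theorem pathLoc_congr {x y : ℕ → ℤ} {n : ℕ} (h : ∀ t ≤ n, x t = y t) (e : ℤ) :
    pathLoc x n e = pathLoc y n e := by
  unfold pathLoc
  congr 1
  refine Finset.filter_congr fun m hm => ?_
  have := Finset.mem_range.1 hm
  rw [h m (by omega), h (m + 1) (by omega)]

theorem tracks_combState {N : ℕ} (hN : 3 ≤ N) {x : ℕ → ℤ}
    (hx : ∀ t ≤ combTime N, x t = combPath N t) : (combState N).Tracks x (combTime N) := by
  refine ⟨by simp [combState], by simp [combState]; omega, ?_, fun e he => ?_, fun e he => ?_,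
    fun e he => ?_, fun e he => ?_, fun e he => ?_, fun e he => ?_, fun t ht => ?_, ?_⟩
  · rw [hx _ le_rfl, combPath_combTime]; simp [combState]
  all_goals try simp only [combState] at *
  · rw [pathLoc_congr hx, show e = N by omega, pathLoc_combPath_self]; simp
  · rw [pathLoc_congr hx, pathLoc_combPath_of_lt N (by omega) (by omega)]; push_cast; ring
  · rw [pathLoc_congr hx, pathLoc_combPath_of_lt N (by omega) (by omega)]; push_cast; ring
  · rw [pathLoc_congr hx, pathLoc_combPath_of_lt N (by omega) (by omega)]; push_cast; ring
  · rw [pathLoc_congr hx, pathLoc_combPath_of_notMem N (by omega)]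
  · rw [pathLoc_congr hx, pathLoc_combPath_of_notMem N (by omega)]
  · rw [hx _ ht]; exact combPath_le ht
  · exact ⟨_, le_rfl, by rw [hx _ le_rfl, combPath_combTime]⟩

theorem tame_combState (N : ℕ) {T : ℝ} (hT : 0 ≤ T) : (combState N).Tame T := by
  refine ⟨by simp [combState], by simp [combState], ?_, ?_, ?_, by simp [combState], ?_, ?_⟩ <;>
    simp only [combState, FrontState.Dhat, FrontState.Echk]
  · simp; linarith
  · simp; linarith
  · simp; linarith [(Nat.cast_nonneg N : (0 : ℝ) ≤ N)]
  · simp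
  · simp

/-- A nearest-neighbour path which follows `combPath N` up to `combTime N`, makes no step against a
strong drift afterwards, and whose compensated sums are small with respect to the sums of the
conditional variances. -/
structure GoodPath (x : ℕ → ℤ) (N : ℕ) : Prop where
  step : ∀ n, |x (n + 1) - x n| = 1
  eq_combPath : ∀ t ≤ combTime N, x t = combPath N t
  unsurprising : ∀ k ≥ combTime N, (2 * log k ≤ pathDelta x k → x (k + 1) ≠ x k + 1) ∧
    (pathDelta x k ≤ -(2 * log k) → x (k + 1) = x k + 1)
  abs_compSum_le : ∀ i, |compSum x (combTime N) i| ≤ varSum x (combTime N) i / 32 + 96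
  abs_compSum_le_mul : ∀ ε > 0, ∃ K, ∀ i,
    |compSum x (combTime N) i| ≤ ε * varSum x (combTime N) i + K

/-- `N` is so large that logarithms of squares are negligible from `N` on. -/
def IsLarge (N : ℕ) : Prop :=
  100000 ≤ N ∧ ∀ M : ℝ, N ≤ M → 2 * log (12 * M ^ 2) ≤ M / 1000

/-- The state of the path `i` steps after `combTime N`. -/
def front (x : ℕ → ℤ) (N : ℕ) : ℕ → FrontState
  | 0 => combState N
  | i + 1 => (front x N i).next (decide (x (combTime N + i + 1) = x (combTime N + i) + 1))

/-- The accumulated error after `i` steps. -/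
def frontErr (N i : ℕ) : ℝ := 2 / ((combTime N : ℝ) - 1) - 2 / ((combTime N : ℝ) + i - 1)

/-- The properties of the state of a good path which are preserved in time. -/
structure FrontInv (x : ℕ → ℤ) (N i : ℕ) (st : FrontState) : Prop where
  tracks : st.Tracks x (combTime N + i)
  tame : st.Tame (2 * log (combTime N + i : ℕ))
  lt_top : N < st.top
  pot_le : |st.pot - compSum x (combTime N) i - (combState N).pot| ≤ frontErr N i
  varPot_le : varSum x (combTime N) i + st.varPot ≤ (combState N).varPot + frontErr N i
  loc_le : ∀ e ≤ st.top - 2, (pathLoc x (combTime N + i) e : ℤ) ≤ 6 * st.top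

theorem two_mul_log_le (k : ℕ) (hk : 0 < k) : 2 * log k ≤ (k : ℝ) / 4 + 12 := by
  have hk' : (0 : ℝ) < k := by exact_mod_cast hk
  have h1 := log_le_sub_one_of_pos (x := (k : ℝ) / 8) (by positivity)
  have h2 := log_le_sub_one_of_pos (x := (8 : ℝ)) (by norm_num)
  rw [log_div hk'.ne' (by norm_num)] at h1
  linarith

theorem pot_combState_mem (N : ℕ) :
    0 ≤ (combState N).pot ∧ (combState N).pot ≤ N / 2 + 8 := by
  have h1 := sigmoidSum_le (y := -2) (t := 0) (by norm_num) le_rfl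
  have h2 := sigmoidSum_le (y := -2 * N - 2) (t := 0)
    (by have := (Nat.cast_nonneg N : (0 : ℝ) ≤ N); linarith) le_rfl
  have h3 := sigmoidSum_nonneg (-2)
  have h4 := sigmoidSum_nonneg (-2 * N - 2)
  have h : (combState N).pot =
      N / 2 + sigmoidSum (-2) + sigmoidSum (-2 * N - 2) := by
    simp only [combState, FrontState.pot, FrontState.Dhat, FrontState.Ehat, FrontState.Echk]
    norm_num
    ring_nf
  rw [h]
  constructor
  · positivity
  · linarith

theorem one_lt_combTime {N : ℕ} (hN : 1 ≤ N) : 3 < combTime N := by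
  unfold combTime; nlinarith

theorem frontErr_nonneg_le_one {N : ℕ} (hN : 1 ≤ N) (i : ℕ) :
    0 ≤ frontErr N i ∧ frontErr N i ≤ 1 := by
  have h : (3 : ℝ) < combTime N := by exact_mod_cast one_lt_combTime hN
  have hi := (Nat.cast_nonneg i : (0 : ℝ) ≤ i)
  unfold frontErr
  have h1 : 2 / ((combTime N : ℝ) + i - 1) ≤ 2 / ((combTime N : ℝ) - 1) := by
    apply div_le_div_of_nonneg_left <;> linarith
  have h2 : 2 / ((combTime N : ℝ) - 1) ≤ 1 := by rw [div_le_one] <;> linarith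
  have h3 : 0 ≤ 2 / ((combTime N : ℝ) + i - 1) := div_nonneg (by norm_num) (by linarith)
  exact ⟨by linarith, by linarith⟩

theorem frontErr_succ {N : ℕ} (hN : 1 ≤ N) (i : ℕ) :
    frontErr N i + 2 * exp (-(2 * log (combTime N + i : ℕ))) ≤ frontErr N (i + 1) := by
  have h : (3 : ℝ) < combTime N := by exact_mod_cast one_lt_combTime hN
  have hi := (Nat.cast_nonneg i : (0 : ℝ) ≤ i)
  have hk : (0 : ℝ) < combTime N + i := by linarith
  have h1 : exp (-(2 * log (combTime N + i : ℕ))) = 1 / ((combTime N : ℝ) + i) ^ 2 := by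
    push_cast
    rw [exp_neg, mul_comm, exp_mul, exp_log hk, one_div]
    norm_cast
  rw [h1]
  unfold frontErr
  push_cast
  have h2 : (combTime N : ℝ) + (i + 1) - 1 = combTime N + i := by ring
  rw [h2]
  have h3 : (3 : ℝ) < combTime N + i := by linarith
  generalize (combTime N : ℝ) + i = k at *
  have h4 : 2 / (k - 1) - 2 / k = 2 / (k * (k - 1)) := by
    have : k - 1 ≠ 0 := by linarith
    field_simp
    ring
  have h5 : 2 * (1 / k ^ 2) ≤ 2 / (k * (k - 1)) := by
    rw [mul_one_div]
    exact div_le_div_of_nonneg_left (by norm_num) (mul_pos hk (by linarith)) (by nlinarith)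
  linarith

section

variable {x : ℕ → ℤ} {N i : ℕ} {st : FrontState}

theorem FrontState.Tame.Dhat_mem {T : ℝ} (h : st.Tame T) (hT : 0 ≤ T) :
    (2 * st.pot + st.top - 2 * T - 20 ≤ st.Dhat) ∧ (st.Dhat : ℝ) ≤ 2 * st.pot + st.top := by
  have hE : (1 : ℝ) ≤ st.Ehat := by
    have h1 := h.one_le_E
    have h2 : 1 ≤ st.Ehat := by unfold FrontState.Ehat; split_ifs <;> omega
    exact_mod_cast h2
  have h1 := sigmoidSum_le (y := st.C - st.Dhat - st.Ehat) (t := T + 1)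
    (by linarith [(abs_le.1 h.abs_C_sub_D).2]) (by linarith)
  have h2 := sigmoidSum_le (y := st.Echk - st.Dhat - 2) (t := T) (by linarith [h.Echk_le]) hT
  have h3 := sigmoidSum_nonneg (st.C - st.Dhat - st.Ehat)
  have h4 := sigmoidSum_nonneg (st.Echk - st.Dhat - 2)
  have h5 : st.pot = st.Dhat / 2 + sigmoidSum (st.C - st.Dhat - st.Ehat) +
    sigmoidSum (st.Echk - st.Dhat - 2) - st.top / 2 := rfl
  constructor <;> linarith

theorem FrontState.Dhat_bounds (st : FrontState) : st.D ≤ st.Dhat ∧ st.Dhat ≤ st.D + 1 := by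
  unfold FrontState.Dhat; split_ifs <;> omega

theorem FrontState.E_le_Echk (st : FrontState) : st.E ≤ st.Echk := by
  unfold FrontState.Echk; split_ifs <;> omega

theorem FrontState.Tracks.time_eq_add {k : ℕ} (h : st.Tracks x k) :
    (k : ℤ) = ∑ e ∈ Finset.range (st.top - 1).toNat, (pathLoc x k e : ℤ) + st.E := by
  have h3 := h.three_le
  obtain ⟨m, hm⟩ := Int.eq_ofNat_of_zero_le (a := st.top - 1) (by omega)
  have h1 : st.top = (m + 1 : ℕ) := by push_cast; omega
  have h2 : ∑ e ∈ Finset.Ico 0 ((m + 1 : ℕ) : ℤ), (pathLoc x k e : ℤ) =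
      ∑ e ∈ Finset.range (m + 1), (pathLoc x k e : ℤ) := by
    rw [← Finset.sum_image (s := Finset.range (m + 1)) (g := fun e : ℕ => (e : ℤ))
      (f := fun e => (pathLoc x k e : ℤ)) (by intro a _ b _ hab; simpa using hab)]
    congr 1
    ext e
    simp only [Finset.mem_Ico, Finset.mem_image, Finset.mem_range]
    constructor
    · rintro ⟨ha, hb⟩
      exact ⟨e.toNat, by omega, by omega⟩
    · rintro ⟨a, ha, rfl⟩
      omega
  rw [hm]
  nth_rw 1 [h.time_eq]
  rw [h1, h2, Finset.sum_range_succ, h.loc_E _ hm.symm]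
  rfl

theorem FrontInv.time_le (h : FrontInv x N i st) :
    ((combTime N + i : ℕ) : ℝ) ≤ 12 * (st.top : ℝ) ^ 2 := by
  have hk : 0 < combTime N + i := by unfold combTime; omega
  have hT := two_mul_log_le _ hk
  have h1 := h.tracks.time_eq_add
  have hE : (st.E : ℝ) ≤ 6 * st.top + 2 * log (combTime N + i : ℕ) + 3 := by
    have h2 := h.tame.Echk_le
    have h3 : (st.E : ℝ) ≤ st.Echk := by exact_mod_cast st.E_le_Echk
    have h4 : (st.Dhat : ℝ) ≤ st.D + 1 := by exact_mod_cast st.Dhat_bounds.2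
    have h5 : (st.D : ℝ) ≤ 6 * st.top := by
      rw [← h.tracks.loc_D _ rfl]
      exact_mod_cast h.loc_le _ le_rfl
    linarith
  have h2 : ∑ e ∈ Finset.range (st.top - 1).toNat, (pathLoc x (combTime N + i) e : ℤ) ≤
      (st.top - 1).toNat * (6 * st.top) := by
    refine (Finset.sum_le_card_nsmul _ _ (6 * st.top) fun e he => h.loc_le _ ?_).trans ?_
    · have := Finset.mem_range.1 he
      omega
    · simp
  have h3 := h.tracks.three_le
  have h4 : ((st.top - 1).toNat : ℤ) = st.top - 1 := by omega
  rw [h4] at h2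
  have h5 : ((combTime N + i : ℕ) : ℤ) ≤ (st.top - 1) * (6 * st.top) + st.E := by linarith
  have h6 : ((combTime N + i : ℕ) : ℝ) ≤ (st.top - 1) * (6 * st.top) + st.E := by
    exact_mod_cast h5
  have h7 : (3 : ℝ) ≤ st.top := by exact_mod_cast h3
  nlinarith

theorem FrontInv.log_time_le (h : FrontInv x N i st) :
    2 * log (combTime N + i : ℕ) ≤ 2 * log (12 * (st.top : ℝ) ^ 2) := by
  have hk : (0 : ℝ) < (combTime N + i : ℕ) := by
    exact_mod_cast (by unfold combTime; omega : 0 < combTime N + i)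
  have := log_le_log hk h.time_le
  linarith

theorem FrontInv.log_time_le_div (h : FrontInv x N i st) (hN : IsLarge N) :
    2 * log (combTime N + i : ℕ) ≤ (st.top : ℝ) / 1000 := by
  refine h.log_time_le.trans (hN.2 _ ?_)
  exact_mod_cast h.lt_top.le

theorem FrontInv.varSum_le (h : FrontInv x N i st) (hN : IsLarge N) :
    varSum x (combTime N) i ≤ 5 * st.top := by
  have h1 := h.varPot_le
  have h2 := (frontErr_nonneg_le_one (by have := hN.1; omega : 1 ≤ N) i).2
  have h3 : (100000 : ℝ) ≤ N := by exact_mod_cast hN.1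
  have h4 : -5 * (st.top : ℝ) ≤ st.varPot := by
    unfold FrontState.varPot
    have := sigmoid_nonneg (st.C - st.Dhat - st.Ehat : ℝ)
    have := sigmoid_nonneg (st.Dhat - st.Echk : ℝ)
    linarith
  have h5 : (combState N).varPot ≤ 4 - 5 * N := by
    unfold FrontState.varPot
    have h6 := sigmoid_le_one ((combState N).C - (combState N).Dhat - (combState N).Ehat : ℝ)
    have h7 := sigmoid_le_one ((combState N).Dhat - (combState N).Echk : ℝ)
    have h8 : ((combState N).top : ℝ) = N + 1 := by simp [combState]
    linarith
  linarith

theorem FrontInv.Dhat_bounds (h : FrontInv x N i st) (hx : GoodPath x N) (hN : IsLarge N) :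
    8 * (2 * log (combTime N + i : ℕ)) + 20 ≤ st.Dhat ∧ (st.Dhat : ℝ) ≤ 4 * st.top := by
  have hT : 0 ≤ 2 * log (combTime N + i : ℕ) :=
    mul_nonneg zero_le_two (log_natCast_nonneg _)
  have hT' := h.log_time_le_div hN
  have h1 := h.tame.Dhat_mem hT
  have h2 := (frontErr_nonneg_le_one (by have := hN.1; omega : 1 ≤ N) i).2
  have h3 : (100000 : ℝ) ≤ N := by exact_mod_cast hN.1
  have h4 : (N : ℝ) ≤ st.top := by exact_mod_cast h.lt_top.le
  have h5 := abs_le.1 (hx.abs_compSum_le i)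
  have h6 := h.varSum_le hN
  have h7 := abs_le.1 h.pot_le
  have h8 := pot_combState_mem N
  constructor <;> linarith

theorem FrontState.next_top (st : FrontState) (r : Bool) :
    (st.next r).top = st.top ∨ (st.next r).top = st.top + 1 ∧ st.pos = 0 := by
  obtain ⟨p, M, B, C, D, E⟩ := st
  match p, r with
  | 0, true => simp [FrontState.next]
  | 0, false => simp [FrontState.next]
  | 1, true => simp [FrontState.next]
  | 1, false => simp [FrontState.next]
  | n + 2, r => simp [FrontState.next]

theorem FrontInv.next (h : FrontInv x N i st) (hx : GoodPath x N) (hN : IsLarge N) :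
    FrontInv x N (i + 1)
      (st.next (decide (x (combTime N + i + 1) = x (combTime N + i) + 1))) ∧
    (st.pos = 2 → x (combTime N + i + 1) = x (combTime N + i) + 1) := by
  have hT : 0 ≤ 2 * log (combTime N + i : ℕ) :=
    mul_nonneg zero_le_two (log_natCast_nonneg _)
  have hTT : 2 * log (combTime N + i : ℕ) ≤ 2 * log (combTime N + (i + 1) : ℕ) := by
    have : (0 : ℝ) < (combTime N + i : ℕ) := by
      exact_mod_cast (by unfold combTime; omega : 0 < combTime N + i)
    have := log_le_log this (y := (combTime N + (i + 1) : ℕ)) (by push_cast; linarith)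
    linarith
  obtain ⟨hD, hD'⟩ := h.Dhat_bounds hx hN
  have hN1 : 1 ≤ N := by have := hN.1; omega
  have hdel := h.tracks.pathDelta_eq
  have hu : st.Unsurprising (2 * log (combTime N + i : ℕ))
      (decide (x (combTime N + i + 1) = x (combTime N + i) + 1)) := by
    have h1 := hx.unsurprising (combTime N + i) (by omega)
    rw [hdel] at h1
    exact ⟨fun h2 => decide_eq_false (h1.1 h2), fun h2 => decide_eq_true (h1.2 h2)⟩
  have h2 : st.pos = 2 → x (combTime N + i + 1) = x (combTime N + i) + 1 := fun hp =>
    of_decide_eq_true (h.tame.right_of_pos hD hT hu hp)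
  refine ⟨?_, h2⟩
  have htr := h.tracks.next (hx.step _) h2
  have hpot := FrontState.abs_pot_next_sub h.tame hD hT hu
  have hvar := FrontState.varPot_next_le h.tame hD hT hu
  have herr := frontErr_succ hN1 i
  have htop := st.next_top (decide (x (combTime N + i + 1) = x (combTime N + i) + 1))
  have hC : compSum x (combTime N) (i + 1) = compSum x (combTime N) i +
      ((if decide (x (combTime N + i + 1) = x (combTime N + i) + 1) then 0 else 1) -
        sigmoid st.delta) := by
    rw [compSum, Finset.sum_range_succ, hdel, ← compSum]
    simp only [decide_eq_true_eq]
  have hV : varSum x (combTime N) (i + 1) = varSum x (combTime N) i +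
      sigmoid st.delta * (1 - sigmoid st.delta) := by
    rw [varSum, Finset.sum_range_succ, hdel, ← varSum]
  refine ⟨htr, h.tame.next hD hT hTT hu, ?_, ?_, ?_, ?_⟩
  · have := h.lt_top
    omega
  · have h3 := abs_le.1 h.pot_le
    have h4 := abs_le.1 hpot
    rw [hC]
    exact abs_le.2 ⟨by linarith, by linarith⟩
  · rw [hV]
    linarith [h.varPot_le]
  · intro e he
    have hk : combTime N + (i + 1) = combTime N + i + 1 := rfl
    have hM : (100000 : ℝ) ≤ st.top := by
      have h3 : (100000 : ℝ) ≤ N := by exact_mod_cast hN.1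
      have h4 : (N : ℝ) ≤ st.top := by exact_mod_cast h.lt_top.le
      linarith
    have hM' : (100000 : ℤ) ≤ st.top := by exact_mod_cast hM
    have hL : (pathLoc x (combTime N + i + 1) e : ℤ) ≤ pathLoc x (combTime N + i) e + 1 := by
      rw [pathLoc_succ]; split_ifs <;> push_cast <;> omega
    rw [hk]
    rcases lt_trichotomy e (st.top - 2) with h3 | h3 | h3
    · rw [h.tracks.pathLoc_succ_of_lt (hx.step _) h2 h3]
      have := h.loc_le e h3.le
      omega
    · rw [h.tracks.loc_D e h3] at hL
      have := st.Dhat_bounds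
      have : st.Dhat ≤ 4 * st.top := by exact_mod_cast hD'
      omega
    · rw [h.tracks.loc_E e (by omega)] at hL
      have h4 := st.E_le_Echk
      have h5 : (st.Echk : ℝ) ≤ 5 * st.top := by
        have := h.tame.Echk_le
        have := h.log_time_le_div hN
        linarith
      have : st.Echk ≤ 5 * st.top := by exact_mod_cast h5
      omega

theorem frontInv_front (hx : GoodPath x N) (hN : IsLarge N) (i : ℕ) :
    FrontInv x N i (front x N i) := by
  induction i with
  | zero =>
    have h := frontErr_nonneg_le_one (by have := hN.1; omega : 1 ≤ N) 0
    refine ⟨tracks_combState (by have := hN.1; omega) hx.eq_combPath,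
      tame_combState N (mul_nonneg zero_le_two (log_natCast_nonneg _)), by simp [front, combState],
      ?_, ?_, ?_⟩
    · simpa [front, compSum] using h.1
    · simpa [front, varSum] using h.1
    · intro e he
      simp only [front, combState] at he ⊢
      rw [add_zero, pathLoc_congr hx.eq_combPath]
      rcases lt_or_ge e 0 with h0 | h0
      · rw [pathLoc_combPath_of_notMem N (Or.inl h0)]
        push_cast
        omega
      · rw [pathLoc_combPath_of_lt N h0 (by omega)]
        push_cast
        omega
  | succ i ih => exact (ih.next hx hN).1

end

theorem exists_two_mul_log_le {ε : ℝ} (hε : 0 < ε) :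
    ∃ K, ∀ M : ℝ, 1 ≤ M → 2 * log (12 * M ^ 2) ≤ ε * M + K := by
  refine ⟨2 * log 12 - 4 * log (ε / 4), fun M hM => ?_⟩
  have hM0 : 0 < M := by linarith
  have h := log_le_sub_one_of_pos (x := ε / 4 * M) (by positivity)
  rw [log_mul (by positivity) (by positivity)] at h
  rw [log_mul (by norm_num) (by positivity), log_pow]
  push_cast
  linarith

theorem exists_isLarge : ∃ N, IsLarge N := by
  obtain ⟨K, hK⟩ := exists_two_mul_log_le (ε := 1 / 2000) (by norm_num)
  obtain ⟨N, hN⟩ := exists_nat_ge (max 100000 (2000 * K))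
  refine ⟨N, by exact_mod_cast (le_max_left _ _).trans hN, fun M hM => ?_⟩
  have h1 := (le_max_left _ _).trans hN
  have h2 := (le_max_right _ _).trans hN
  linarith [hK M (by linarith)]

section

variable {x : ℕ → ℤ} {N : ℕ}

theorem exists_abs_Dhat_sub_top_le (hx : GoodPath x N) (hN : IsLarge N) {ε : ℝ} (hε : 0 < ε) :
    ∃ K, 0 ≤ K ∧ ∀ i, |((front x N i).Dhat : ℝ) - (front x N i).top| ≤
      ε * (front x N i).top + K := by
  obtain ⟨K₁, h₁⟩ := hx.abs_compSum_le_mul (ε / 20) (by positivity)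
  obtain ⟨K₂, h₂⟩ := exists_two_mul_log_le (ε := ε / 4) (by positivity)
  refine ⟨max 0 (2 * K₁ + 2 * K₂ + 2 * (combState N).pot + 22), le_max_left _ _, fun i => ?_⟩
  have h := frontInv_front hx hN i
  generalize front x N i = st at *
  have hT : 0 ≤ 2 * log (combTime N + i : ℕ) :=
    mul_nonneg zero_le_two (log_natCast_nonneg _)
  have h1 := h.tame.Dhat_mem hT
  have h2 := (frontErr_nonneg_le_one (by have := hN.1; omega : 1 ≤ N) i).2
  have h3 : (3 : ℝ) ≤ st.top := by exact_mod_cast h.tracks.three_le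
  have h4 := h.log_time_le.trans (h₂ st.top (by linarith))
  have h5 := abs_le.1 (h₁ i)
  have h6 := mul_le_mul_of_nonneg_left (h.varSum_le hN) (by positivity : 0 ≤ ε / 20)
  have h7 := abs_le.1 h.pot_le
  have h8 := (pot_combState_mem N).1
  have h9 := le_max_right 0 (2 * K₁ + 2 * K₂ + 2 * (combState N).pot + 22)
  have h10 : 0 ≤ ε * st.top := by positivity
  exact abs_le.2 ⟨by linarith, by linarith⟩

theorem front_pathLoc_succ (hx : GoodPath x N) (hN : IsLarge N) {i : ℕ} {e : ℤ}
    (he : e < (front x N (i + 1)).top - 2) : e ≤ (front x N i).top - 2 ∧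
      pathLoc x (combTime N + (i + 1)) e = pathLoc x (combTime N + i) e := by
  have h := frontInv_front hx hN i
  have h2 := (h.next hx hN).2
  have htop : (front x N (i + 1)).top = (front x N i).top ∨
      (front x N (i + 1)).top = (front x N i).top + 1 ∧ (front x N i).pos = 0 :=
    FrontState.next_top _ _
  rcases htop with htop | ⟨htop, hp⟩
  · rw [htop] at he
    exact ⟨he.le, h.tracks.pathLoc_succ_of_lt (hx.step _) h2 he⟩
  · refine ⟨by omega, ?_⟩
    have h3 := (frontInv_front hx hN (i + 1)).tracks.apply_eq
    have h4 := (frontInv_front hx hN (i + 1)).tracks.pos_le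
    have h5 := h.tracks.apply_eq
    rw [← add_assoc] at h3 ⊢
    rw [pathLoc_succ, if_neg, add_zero]
    omega

theorem exists_abs_pathLoc_sub_le (hx : GoodPath x N) (hN : IsLarge N) {ε : ℝ} (hε : 0 < ε) :
    ∃ K, 0 ≤ K ∧ ∀ i, ∀ e : ℤ, 0 ≤ e → e ≤ (front x N i).top - 2 →
      |(pathLoc x (combTime N + i) e : ℝ) - e| ≤ ε * e + K := by
  obtain ⟨K, hK, h⟩ := exists_abs_Dhat_sub_top_le hx hN hε
  refine ⟨K + 2 * ε + 3 + (2 * N + 1), by positivity, fun i => ?_⟩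
  have hlast : ∀ i, ∀ e : ℤ, e = (front x N i).top - 2 →
      |(pathLoc x (combTime N + i) e : ℝ) - e| ≤ ε * e + (K + 2 * ε + 3) := by
    intro i e he
    have h1 : ((pathLoc x (combTime N + i) e : ℤ) : ℝ) = (front x N i).D := by
      rw [(frontInv_front hx hN i).tracks.loc_D e he]
    have h2 := (front x N i).Dhat_bounds
    have h3 : ((front x N i).D : ℝ) ≤ (front x N i).Dhat := by exact_mod_cast h2.1
    have h4 : ((front x N i).Dhat : ℝ) ≤ (front x N i).D + 1 := by exact_mod_cast h2.2
    have h5 : (e : ℝ) = (front x N i).top - 2 := by rw [he]; push_cast; ring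
    have h6 := abs_le.1 (h i)
    rw [Int.cast_natCast] at h1
    rw [h1]
    have h7 : ε * (front x N i).top = ε * e + 2 * ε := by rw [h5]; ring
    exact abs_le.2 ⟨by linarith, by linarith⟩
  induction i with
  | zero =>
    intro e h0 he
    have h1 : (combState N).top = N + 1 := rfl
    rw [add_zero, pathLoc_congr hx.eq_combPath, pathLoc_combPath_of_lt N h0
      (by simp only [front, h1] at he; omega)]
    have h2 : (e : ℝ) ≤ N := by
      have : e ≤ N := by simp only [front, h1] at he; omega
      exact_mod_cast this
    have h3 : (0 : ℝ) ≤ e := by exact_mod_cast h0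
    have h4 := mul_nonneg hε.le h3
    push_cast
    exact abs_le.2 ⟨by linarith, by linarith⟩
  | succ i ih =>
    intro e h0 he
    rcases he.lt_or_eq with he | he
    · obtain ⟨h1, h2⟩ := front_pathLoc_succ hx hN he
      rw [h2]
      exact ih e h0 h1
    · have := (Nat.cast_nonneg N : (0 : ℝ) ≤ N)
      linarith [hlast _ e he]

theorem exists_abs_time_sub_le (hx : GoodPath x N) (hN : IsLarge N) {ε : ℝ} (hε : 0 < ε) :
    ∃ K, ∀ i, |((combTime N + i : ℕ) : ℝ) - (front x N i).top ^ 2 / 2| ≤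
      ε * (front x N i).top ^ 2 + K * (front x N i).top := by
  obtain ⟨K, hK, h⟩ := exists_abs_pathLoc_sub_le hx hN hε
  refine ⟨K + 10, fun i => ?_⟩
  have hi := frontInv_front hx hN i
  have hT := hi.log_time_le_div hN
  have hD := (hi.Dhat_bounds hx hN).2
  have h3 := hi.tracks.three_le
  have hE : (1 : ℝ) ≤ (front x N i).E ∧ ((front x N i).E : ℝ) ≤ 5 * (front x N i).top + 2 := by
    have h2 := hi.tame.Echk_le
    have h4 : ((front x N i).E : ℝ) ≤ (front x N i).Echk := by
      exact_mod_cast (front x N i).E_le_Echk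
    have h3' : (3 : ℝ) ≤ (front x N i).top := by exact_mod_cast h3
    exact ⟨by exact_mod_cast hi.tame.one_le_E, by linarith⟩
  have ht := hi.tracks.time_eq_add
  have hl := h i
  generalize front x N i = st at *
  obtain ⟨m, hm⟩ := Int.eq_ofNat_of_zero_le (a := st.top - 1) (by omega)
  have hm' : (st.top : ℝ) = m + 1 := by
    have : st.top = m + 1 := by omega
    exact_mod_cast this
  rw [hm, Int.toNat_natCast] at ht
  have ht' : ((combTime N + i : ℕ) : ℝ) =
      ∑ e ∈ Finset.range m, (pathLoc x (combTime N + i) e : ℝ) + st.E := by exact_mod_cast ht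
  have hgauss : ∑ e ∈ Finset.range m, (e : ℝ) = m * (m - 1) / 2 := by
    clear * -
    induction m with
    | zero => simp
    | succ m ih => rw [Finset.sum_range_succ, ih]; push_cast; ring
  have hsum : |∑ e ∈ Finset.range m, (pathLoc x (combTime N + i) e : ℝ) -
      ∑ e ∈ Finset.range m, (e : ℝ)| ≤ ε * (m * (m - 1) / 2) + m * K := by
    rw [← Finset.sum_sub_distrib]
    refine (Finset.abs_sum_le_sum_abs _ _).trans ?_
    refine (Finset.sum_le_sum (g := fun e : ℕ => ε * e + K) fun e he => ?_).trans ?_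
    · have := hl e (by omega) (by have := Finset.mem_range.1 he; omega)
      exact_mod_cast this
    · rw [Finset.sum_add_distrib, ← Finset.mul_sum, hgauss]
      simp
  rw [hgauss] at hsum
  have hs := abs_le.1 hsum
  have hm2 : (2 : ℝ) ≤ m := by
    have : 2 ≤ m := by omega
    exact_mod_cast this
  have hmm : (0:ℝ) ≤ ε * (m * (m - 1) / 2) ∧
      ε * (m * (m - 1) / 2) ≤ ε * (m + 1) ^ 2 := by
    constructor
    · have : (0 : ℝ) ≤ m * (m - 1) / 2 := by nlinarith
      positivity
    · refine mul_le_mul_of_nonneg_left ?_ hε.le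
      nlinarith
  rw [hm'] at hE
  rw [ht', hm']
  have hKm : 0 ≤ K * m := by positivity
  exact abs_le.2 ⟨by nlinarith, by nlinarith⟩

/-- A good path visits all nonnegative sites, and its hitting times are asymptotically
`x ^ 2 / 2`. -/
theorem GoodPath.tendsto_hitting (hx : GoodPath x N) (hN : IsLarge N) :
    (∀ y : ℕ, ∃ n : ℕ, x n = (y : ℤ)) ∧
      Tendsto (fun y : ℕ => ((sInf {n : ℕ | x n = (y : ℤ)} : ℕ) : ℝ) / (y : ℝ) ^ 2)
        atTop (nhds (1 / 2)) := by
  have h0 : x 0 = 0 := by rw [hx.eq_combPath 0 (Nat.zero_le _), combPath_zero]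
  have hit : ∀ y : ℕ, ∃ n : ℕ, x n = (y : ℤ) := by
    intro y
    have hi := frontInv_front hx hN (12 * y ^ 2)
    obtain ⟨t, -, ht⟩ := hi.tracks.exists_eq_top
    have h1 := hi.time_le
    have h2 : (y : ℤ) ≤ x t := by
      rw [ht]
      by_contra! hc
      have h3 := hi.tracks.three_le
      have h4 : ((front x N (12 * y ^ 2)).top : ℝ) ≤ y := by exact_mod_cast hc.le
      have h5 : (0 : ℝ) ≤ (front x N (12 * y ^ 2)).top := by
        exact_mod_cast (by omega : 0 ≤ (front x N (12 * y ^ 2)).top)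
      have h6 : (1 : ℝ) ≤ combTime N := by
        exact_mod_cast (by unfold combTime; omega : 1 ≤ combTime N)
      push_cast at h1
      nlinarith
    obtain ⟨j, -, hj⟩ := exists_le_eq_of_le h0 hx.step (by omega) h2
    exact ⟨j, hj⟩
  refine ⟨hit, ?_⟩
  have key : ∀ y : ℕ, N + 1 < y → ∃ i, sInf {n : ℕ | x n = (y : ℤ)} = combTime N + i ∧
      (front x N i).top = y := by
    intro y hy
    have hmem : x (sInf {n : ℕ | x n = (y : ℤ)}) = y := Nat.sInf_mem (hit y)
    have hle : ∀ n, x n = y → sInf {n : ℕ | x n = (y : ℤ)} ≤ n := fun n hn => Nat.sInf_le hn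
    generalize sInf {n : ℕ | x n = (y : ℤ)} = k at *
    have hk : combTime N ≤ k := by
      by_contra! hc
      have := combPath_le hc.le
      rw [← hx.eq_combPath k hc.le] at this
      omega
    obtain ⟨i, rfl⟩ := Nat.exists_eq_add_of_le hk
    refine ⟨i, rfl, ?_⟩
    have hi := (frontInv_front hx hN i).tracks
    obtain ⟨t, ht, htt⟩ := hi.exists_eq_top
    have h1 := hi.le_top _ le_rfl
    obtain ⟨j, hj, hjy⟩ := exists_le_eq_of_le h0 hx.step (a := y) (by omega) (k := t) (by omega)
    have h2 := hle j hjy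
    have h3 : t = combTime N + i := by omega
    rw [← htt, h3, hmem]
  rw [Metric.tendsto_atTop]
  intro ε hε
  obtain ⟨K, hK⟩ := exists_abs_time_sub_le hx hN (ε := ε / 2) (by positivity)
  obtain ⟨m, hm⟩ := exists_nat_gt (2 * K / ε)
  refine ⟨max m (N + 2), fun y hy => ?_⟩
  obtain ⟨i, hi, htop⟩ := key y (by have := (le_max_right _ _).trans hy; omega)
  have h1 := hK i
  rw [htop, Int.cast_natCast] at h1
  have hy0 : (0 : ℝ) < y := by
    have := (le_max_right _ _).trans hy
    exact_mod_cast (by omega : 0 < y)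
  have hmy : (m : ℝ) ≤ y := by exact_mod_cast (le_max_left _ _).trans hy
  have h2 : 2 * K < ε * y := by
    have := (div_lt_iff₀ hε).1 (hm.trans_le hmy)
    linarith
  rw [hi, Real.dist_eq]
  have h3 : ((combTime N + i : ℕ) : ℝ) / (y : ℝ) ^ 2 - 1 / 2 =
      (((combTime N + i : ℕ) : ℝ) - (y : ℝ) ^ 2 / 2) / (y : ℝ) ^ 2 := by
    field_simp
  rw [h3, abs_div, abs_of_pos (by positivity : (0 : ℝ) < (y : ℝ) ^ 2), div_lt_iff₀ (by positivity)]
  nlinarith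

end

theorem dependsOn_pathDelta (n : ℕ) : DependsOn (fun x => pathDelta x n) (Iic n) := by
  intro x y h
  simp only [pathDelta]
  rw [h n (mem_Iic.2 le_rfl), pathLoc_congr h, pathLoc_congr h, pathLoc_congr h, pathLoc_congr h]

theorem dependsOn_compSum (n i : ℕ) : DependsOn (fun x => compSum x n i) (Iic (n + i)) := by
  intro x y h
  refine Finset.sum_congr rfl fun m hm => ?_
  have hm := Finset.mem_range.1 hm
  have hd : pathDelta x (n + m) = pathDelta y (n + m) :=
    dependsOn_pathDelta _ fun t ht => h t (by simp only [mem_Iic] at *; omega)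
  rw [hd, h (n + m) (by simp only [mem_Iic]; omega), h (n + m + 1) (by simp only [mem_Iic]; omega)]

theorem dependsOn_varSum (n i : ℕ) : DependsOn (fun x => varSum x n i) (Iic (n + i)) := by
  intro x y h
  refine Finset.sum_congr rfl fun m hm => ?_
  have hm := Finset.mem_range.1 hm
  have hd : pathDelta x (n + m) = pathDelta y (n + m) :=
    dependsOn_pathDelta _ fun t ht => h t (by simp only [mem_Iic] at *; omega)
  rw [hd]

theorem walkF_neg_div_two (y : ℝ) : walkF (-y / 2) = 1 - sigmoid y := by
  rw [← sigmoid_neg, walkF, sigmoid_def, neg_neg]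
  have h : exp (-y / 2) ≠ 0 := (exp_pos _).ne'
  have h1 : exp (-(-y / 2)) = exp (-y / 2) * exp y := by rw [← exp_add]; ring_nf
  rw [h1]
  have h2 : 1 + exp y ≠ 0 := by positivity
  field_simp

section

variable {Ω : Type*} {X : ℕ → Ω → ℤ}

theorem measurable_walkFiltration_of_dependsOn {β : Type*} [MeasurableSpace β]
    {F : (ℕ → ℤ) → β} {n : ℕ} (hF : DependsOn F (Iic n)) :
    Measurable[walkFiltration X n] fun ω => F fun m => X m ω := by
  let _ : MeasurableSpace Ω := walkFiltration X n
  have hX : ∀ m ≤ n, Measurable (X m) := fun m hm => by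
    refine Measurable.mono (comap_measurable (X m)) ?_ le_rfl
    exact le_iSup₂_of_le (f := fun m (_ : m ∈ Finset.range (n + 1)) =>
      MeasurableSpace.comap (X m) inferInstance) m (Finset.mem_range.2 (by omega)) le_rfl
  have hP : Measurable fun ω (m : Fin (n + 1)) => X m ω :=
    measurable_pi_iff.2 fun m => hX m (by omega)
  intro s _
  have : (fun ω => F fun m => X m ω) ⁻¹' s =
      (fun ω (m : Fin (n + 1)) => X m ω) ⁻¹'
        ((fun ω (m : Fin (n + 1)) => X m ω) '' ((fun ω => F fun m => X m ω) ⁻¹' s)) := by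
    refine subset_antisymm (subset_preimage_image _ _) fun ω ⟨ω', h1, h2⟩ => ?_
    have : F (fun m => X m ω) = F fun m => X m ω' := hF fun m hm =>
      (congrFun h2 (⟨m, Nat.lt_succ_of_le hm⟩ : Fin (n + 1))).symm
    rw [mem_preimage, this]
    exact h1
  rw [this]
  exact hP (to_countable _).measurableSet

variable [mΩ : MeasurableSpace Ω]

theorem walkFiltration_le (hmeas : ∀ n, Measurable (X n)) (n : ℕ) : walkFiltration X n ≤ mΩ :=
  iSup₂_le fun m _ => (hmeas m).comap_le

theorem measurable_of_dependsOn (hmeas : ∀ n, Measurable (X n)) {β : Type*} [MeasurableSpace β]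
    {F : (ℕ → ℤ) → β} {n : ℕ} (hF : DependsOn F (Iic n)) :
    Measurable fun ω => F fun m => X m ω :=
  (measurable_walkFiltration_of_dependsOn hF).mono (walkFiltration_le hmeas n) le_rfl

variable {μ : Measure Ω} [IsProbabilityMeasure μ]

theorem integrable_of_dependsOn (hmeas : ∀ n, Measurable (X n)) {F : (ℕ → ℤ) → ℝ} {n : ℕ}
    (hF : DependsOn F (Iic n)) {C : ℝ} (hC : ∀ x, |F x| ≤ C) :
    Integrable (fun ω => F fun m => X m ω) μ :=
  Integrable.of_bound (measurable_of_dependsOn hmeas hF).aestronglyMeasurable C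
    (ae_of_all _ fun _ => hC _)

theorem integral_mul_right (hmeas : ∀ n, Measurable (X n))
    (hdrive : ∀ n,
      μ[(fun ω => if X (n + 1) ω = X n ω + 1 then (1 : ℝ) else 0) | walkFiltration X n]
        =ᵐ[μ] fun ω => walkF (-(Δ X n ω) / 2))
    {F : (ℕ → ℤ) → ℝ} {n : ℕ} (hF : DependsOn F (Iic n)) {C : ℝ} (hC : ∀ x, |F x| ≤ C) :
    ∫ ω, F (fun m => X m ω) * (if X (n + 1) ω = X n ω + 1 then (1 : ℝ) else 0) ∂μ =
      ∫ ω, F (fun m => X m ω) * (1 - sigmoid (pathDelta (fun m => X m ω) n)) ∂μ := by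
  have hR : Integrable (fun ω => if X (n + 1) ω = X n ω + 1 then (1 : ℝ) else 0) μ := by
    refine integrable_of_dependsOn hmeas (F := fun x => if x (n + 1) = x n + 1 then (1 : ℝ) else 0)
      (n := n + 1) (fun x y h => ?_) (C := 1) fun x => ?_
    · simp only
      rw [h n (by simp), h (n + 1) (by simp)]
    · split_ifs <;> simp
  have hm : Measurable[walkFiltration X n] fun ω => F fun m => X m ω :=
    measurable_walkFiltration_of_dependsOn hF
  have hFR : Integrable ((fun ω => F (fun m => X m ω)) *
      fun ω => if X (n + 1) ω = X n ω + 1 then (1 : ℝ) else 0) μ :=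
    hR.bdd_mul (c := C) (measurable_of_dependsOn hmeas hF).aestronglyMeasurable
      (ae_of_all _ fun _ => hC _)
  have h1 := condExp_mul_of_stronglyMeasurable_left hm.stronglyMeasurable hFR hR
  have h2 := integral_condExp (μ := μ) (walkFiltration_le hmeas n)
    (f := (fun ω => F (fun m => X m ω)) *
      fun ω => if X (n + 1) ω = X n ω + 1 then (1 : ℝ) else 0)
  simp only [Pi.mul_apply] at h2
  rw [← h2]
  refine integral_congr_ae ?_
  filter_upwards [h1, hdrive n] with ω h3 h4
  rw [h3, Pi.mul_apply, h4, walkF_neg_div_two]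
  rfl

theorem integral_ite_right (hmeas : ∀ n, Measurable (X n))
    (hdrive : ∀ n,
      μ[(fun ω => if X (n + 1) ω = X n ω + 1 then (1 : ℝ) else 0) | walkFiltration X n]
        =ᵐ[μ] fun ω => walkF (-(Δ X n ω) / 2))
    {F G : (ℕ → ℤ) → ℝ} {n : ℕ} (hF : DependsOn F (Iic n)) (hG : DependsOn G (Iic n))
    {C : ℝ} (hFC : ∀ x, |F x| ≤ C) (hGC : ∀ x, |G x| ≤ C) :
    ∫ ω, (if X (n + 1) ω = X n ω + 1 then F fun m => X m ω else G fun m => X m ω) ∂μ =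
      ∫ ω, (F (fun m => X m ω) * (1 - sigmoid (pathDelta (fun m => X m ω) n)) +
        G (fun m => X m ω) * sigmoid (pathDelta (fun m => X m ω) n)) ∂μ := by
  have hFG : DependsOn (fun x => F x - G x) (Iic n) := fun x y h => by
    simp only [hF h, hG h]
  have hFGC : ∀ x, |F x - G x| ≤ C + C := fun x =>
    (abs_sub _ _).trans (add_le_add (hFC x) (hGC x))
  have h := integral_mul_right (μ := μ) hmeas hdrive hFG hFGC
  have hGi : Integrable (fun ω => G fun m => X m ω) μ := integrable_of_dependsOn hmeas hG hGC
  have hi : Integrable (fun ω => (F (fun m => X m ω) - G (fun m => X m ω)) *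
      (if X (n + 1) ω = X n ω + 1 then (1 : ℝ) else 0)) μ := by
    refine integrable_of_dependsOn hmeas
      (F := fun x => (F x - G x) * if x (n + 1) = x n + 1 then (1 : ℝ) else 0)
      (n := n + 1) (fun x y h => ?_) (C := C + C) fun x => ?_
    · have h' : ∀ m ∈ Iic n, x m = y m := fun m hm => h m (by simp only [mem_Iic] at *; omega)
      simp only
      rw [h n (by simp), h (n + 1) (by simp), hF h', hG h']
    · split_ifs
      · simpa using hFGC x
      · simpa using (abs_nonneg _).trans (hFGC x)
  have hi' : Integrable (fun ω => (F (fun m => X m ω) - G (fun m => X m ω)) *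
      (1 - sigmoid (pathDelta (fun m => X m ω) n))) μ := by
    refine integrable_of_dependsOn hmeas
      (F := fun x => (F x - G x) * (1 - sigmoid (pathDelta x n)))
      (n := n) (fun x y h => ?_) (C := C + C) fun x => ?_
    · have := dependsOn_pathDelta n h
      simp only at this ⊢
      rw [hF h, hG h, this]
    · rw [abs_mul]
      have h1 := sigmoid_nonneg (pathDelta x n)
      have h2 := sigmoid_le_one (pathDelta x n)
      have h3 : |1 - sigmoid (pathDelta x n)| ≤ 1 := abs_le.2 ⟨by linarith, by linarith⟩
      exact (mul_le_of_le_one_right (abs_nonneg _) h3).trans (hFGC x)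
  calc _ = ∫ ω, (G (fun m => X m ω) + (F (fun m => X m ω) - G (fun m => X m ω)) *
      (if X (n + 1) ω = X n ω + 1 then (1 : ℝ) else 0)) ∂μ := by
        congr 1
        ext ω
        split_ifs <;> ring
    _ = ∫ ω, (G (fun m => X m ω) + (F (fun m => X m ω) - G (fun m => X m ω)) *
      (1 - sigmoid (pathDelta (fun m => X m ω) n))) ∂μ := by
        rw [integral_add hGi hi, integral_add hGi hi', h]
    _ = _ := by
        congr 1
        ext ω
        ring

end

/-- The exponential of the compensated sum, with the compensator that makes it a
supermartingale. -/
def expSum (θ : ℝ) (x : ℕ → ℤ) (n i : ℕ) : ℝ :=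
  exp (θ * compSum x n i - θ ^ 2 * varSum x n i)

/-- The factor by which `expSum` changes in a step. -/
def expStep (θ q : ℝ) (right : Bool) : ℝ :=
  exp (θ * ((if right then 0 else 1) - q) - θ ^ 2 * (q * (1 - q)))

theorem expStep_mean_le {θ q : ℝ} (hθ : |θ| ≤ 1) (hq : 0 ≤ q) (hq1 : q ≤ 1) :
    expStep θ q true * (1 - q) + expStep θ q false * q ≤ 1 := by
  have hθ' := abs_le.1 hθ
  have h : ∀ y, |y| ≤ 1 → exp y ≤ 1 + y + y ^ 2 := fun y hy => by
    linarith [(abs_le.1 (abs_exp_sub_one_sub_id_le hy)).2]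
  have ha : |θ * (0 - q)| ≤ 1 := by
    rw [abs_mul]
    exact mul_le_one₀ hθ (abs_nonneg _) (abs_le.2 ⟨by linarith, by linarith⟩)
  have hb : |θ * (1 - q)| ≤ 1 := by
    rw [abs_mul]
    exact mul_le_one₀ hθ (abs_nonneg _) (abs_le.2 ⟨by linarith, by linarith⟩)
  have h1 := mul_le_mul_of_nonneg_right (h _ ha) (by linarith : 0 ≤ 1 - q)
  have h2 := mul_le_mul_of_nonneg_right (h _ hb) hq
  have h3 := add_one_le_exp (θ ^ 2 * (q * (1 - q)))
  have h4 : exp (θ * (0 - q)) * (1 - q) + exp (θ * (1 - q)) * q ≤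
      exp (θ ^ 2 * (q * (1 - q))) := by
    refine le_trans ?_ h3
    nlinarith
  have h5 : expStep θ q true * (1 - q) + expStep θ q false * q =
      (exp (θ * (0 - q)) * (1 - q) + exp (θ * (1 - q)) * q) *
        exp (-(θ ^ 2 * (q * (1 - q)))) := by
    simp only [expStep, sub_eq_add_neg (θ * _), exp_add, if_true, Bool.false_eq_true, if_false]
    ring
  rw [h5, exp_neg, ← div_eq_mul_inv]
  exact div_le_one_of_le₀ h4 (exp_pos _).le

theorem expStep_le {θ q : ℝ} (hθ : |θ| ≤ 1) (hq : 0 ≤ q) (hq1 : q ≤ 1) (r : Bool) :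
    expStep θ q r ≤ exp 1 := by
  refine exp_le_exp.2 ?_
  have h1 : |(if r then 0 else 1) - q| ≤ 1 := by
    split_ifs <;> exact abs_le.2 ⟨by linarith, by linarith⟩
  have h2 : θ * ((if r then 0 else 1) - q) ≤ 1 := by
    refine (le_abs_self _).trans ?_
    rw [abs_mul]
    exact mul_le_one₀ hθ (abs_nonneg _) h1
  have h3 : 0 ≤ θ ^ 2 * (q * (1 - q)) :=
    mul_nonneg (sq_nonneg _) (mul_nonneg hq (by linarith))
  linarith

theorem expSum_succ (θ : ℝ) (x : ℕ → ℤ) (n i : ℕ) :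
    expSum θ x n (i + 1) = expSum θ x n i *
      expStep θ (sigmoid (pathDelta x (n + i))) (decide (x (n + i + 1) = x (n + i) + 1)) := by
  rw [expSum, expSum, expStep, ← exp_add, compSum, varSum, Finset.sum_range_succ,
    Finset.sum_range_succ, ← compSum, ← varSum]
  congr 1
  simp only [decide_eq_true_eq]
  ring

theorem expSum_pos (θ : ℝ) (x : ℕ → ℤ) (n i : ℕ) : 0 < expSum θ x n i := exp_pos _

theorem dependsOn_expSum (θ : ℝ) (n i : ℕ) :
    DependsOn (fun x => expSum θ x n i) (Iic (n + i)) := fun x y h => by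
  have h1 := dependsOn_compSum n i h
  have h2 := dependsOn_varSum n i h
  simp only at h1 h2
  simp only [expSum, h1, h2]

open Classical in
/-- The process `expSum`, replaced by `K` from the first time it reaches `K`, on the paths
satisfying `P`. -/
def haltedExp (P : (ℕ → ℤ) → Prop) (θ K : ℝ) (n i : ℕ) (x : ℕ → ℤ) : ℝ :=
  if P x then if ∀ j ≤ i, expSum θ x n j < K then expSum θ x n i else K else 0

theorem dependsOn_forall_expSum_lt (θ K : ℝ) (n i : ℕ) :
    DependsOn (fun x => ∀ j ≤ i, expSum θ x n j < K) (Iic (n + i)) := fun x y h => by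
  refine propext (forall₂_congr fun j hj => ?_)
  have := dependsOn_expSum θ n j (x := x) (y := y) fun t ht =>
    h t (by simp only [mem_Iic] at *; omega)
  simp only at this
  rw [this]

theorem DependsOn.mono_Iic {β : Type*} {F : (ℕ → ℤ) → β} {n m : ℕ} (hF : DependsOn F (Iic n))
    (h : n ≤ m) : DependsOn F (Iic m) := fun _ _ hxy => hF fun t ht => hxy t (le_trans ht h)

theorem dependsOn_haltedExp {P : (ℕ → ℤ) → Prop} {n : ℕ} (hP : DependsOn P (Iic n)) (θ K : ℝ)
    (i : ℕ) : DependsOn (haltedExp P θ K n i) (Iic (n + i)) := fun x y h => by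
  have h1 := DependsOn.mono_Iic hP (Nat.le_add_right n i) h
  have h2 := dependsOn_expSum θ n i h
  have h3 := dependsOn_forall_expSum_lt θ K n i h
  simp only at h1 h2 h3
  by_cases hx : P x
  · have hy : P y := h1 ▸ hx
    simp only [haltedExp, if_pos hx, if_pos hy, h2, h3]
  · have hy : ¬ P y := h1 ▸ hx
    simp only [haltedExp, if_neg hx, if_neg hy]

theorem haltedExp_nonneg_le (P : (ℕ → ℤ) → Prop) (θ : ℝ) {K : ℝ} (hK : 0 ≤ K) (n i : ℕ)
    (x : ℕ → ℤ) : 0 ≤ haltedExp P θ K n i x ∧ haltedExp P θ K n i x ≤ K := by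
  unfold haltedExp
  split_ifs with h1 h2
  · exact ⟨(expSum_pos _ _ _ _).le, (h2 i le_rfl).le⟩
  · exact ⟨hK, le_rfl⟩
  · exact ⟨le_rfl, hK⟩

open Classical in
/-- A bound for `haltedExp` one step later, in terms of the present and the next step. -/
def haltedExpNext (P : (ℕ → ℤ) → Prop) (θ K : ℝ) (n i : ℕ) (r : Bool) (x : ℕ → ℤ) : ℝ :=
  if P x then if ∀ j ≤ i, expSum θ x n j < K then
    expSum θ x n i * expStep θ (sigmoid (pathDelta x (n + i))) r else K else 0

theorem dependsOn_haltedExpNext {P : (ℕ → ℤ) → Prop} {n : ℕ} (hP : DependsOn P (Iic n))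
    (θ K : ℝ) (i : ℕ) (r : Bool) :
    DependsOn (haltedExpNext P θ K n i r) (Iic (n + i)) := fun x y h => by
  have h1 := DependsOn.mono_Iic hP (Nat.le_add_right n i) h
  have h2 := dependsOn_expSum θ n i h
  have h3 := dependsOn_forall_expSum_lt θ K n i h
  have h4 := dependsOn_pathDelta (n + i) h
  simp only at h1 h2 h3 h4
  by_cases hx : P x
  · have hy : P y := h1 ▸ hx
    simp only [haltedExpNext, if_pos hx, if_pos hy, h2, h3, h4]
  · have hy : ¬ P y := h1 ▸ hx
    simp only [haltedExpNext, if_neg hx, if_neg hy]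

theorem abs_haltedExpNext_le (P : (ℕ → ℤ) → Prop) {θ K : ℝ} (hθ : |θ| ≤ 1) (hK : 0 ≤ K)
    (n i : ℕ) (r : Bool) (x : ℕ → ℤ) : |haltedExpNext P θ K n i r x| ≤ K * exp 1 := by
  have h1 : 1 ≤ exp 1 := one_le_exp zero_le_one
  unfold haltedExpNext
  split_ifs with h2 h3
  · have hs : 0 ≤ expStep θ (sigmoid (pathDelta x (n + i))) r := (exp_pos _).le
    rw [abs_of_nonneg (mul_nonneg (expSum_pos _ _ _ _).le hs)]
    exact mul_le_mul (h3 i le_rfl).le (expStep_le hθ (sigmoid_nonneg _) (sigmoid_le_one _) r)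
      (exp_pos _).le hK
  · rw [abs_of_nonneg hK]
    exact le_mul_of_one_le_right hK h1
  · rw [abs_zero]
    positivity

theorem haltedExp_succ_le (P : (ℕ → ℤ) → Prop) (θ K : ℝ) (n i : ℕ) (x : ℕ → ℤ) :
    haltedExp P θ K n (i + 1) x ≤
      haltedExpNext P θ K n i (decide (x (n + i + 1) = x (n + i) + 1)) x := by
  unfold haltedExp haltedExpNext
  rw [← expSum_succ]
  by_cases hP : P x
  · rw [if_pos hP, if_pos hP]
    by_cases h1 : ∀ j ≤ i, expSum θ x n j < K
    · rw [if_pos h1]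
      split_ifs with h2
      · exact le_rfl
      · by_contra! hc
        refine h2 fun j hj => ?_
        rcases Nat.le_succ_iff.1 hj with h | rfl
        · exact h1 j h
        · exact hc
    · rw [if_neg h1, if_neg fun h => h1 fun j hj => h j (hj.trans (Nat.le_succ i))]
  · rw [if_neg hP, if_neg hP]

theorem haltedExpNext_mean_le (P : (ℕ → ℤ) → Prop) {θ K : ℝ} (hθ : |θ| ≤ 1)
    (n i : ℕ) (x : ℕ → ℤ) :
    haltedExpNext P θ K n i true x * (1 - sigmoid (pathDelta x (n + i))) +
      haltedExpNext P θ K n i false x * sigmoid (pathDelta x (n + i)) ≤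
        haltedExp P θ K n i x := by
  have h := expStep_mean_le hθ (sigmoid_nonneg (pathDelta x (n + i)))
    (sigmoid_le_one (pathDelta x (n + i)))
  unfold haltedExp haltedExpNext
  split_ifs
  · have := mul_le_mul_of_nonneg_left h (expSum_pos θ x n i).le
    linarith
  · linarith
  · linarith

section

variable {Ω : Type*} {X : ℕ → Ω → ℤ} [mΩ : MeasurableSpace Ω] {μ : Measure Ω}
  [IsProbabilityMeasure μ]

theorem integral_haltedExp_le (hmeas : ∀ n, Measurable (X n))
    (hdrive : ∀ n,
      μ[(fun ω => if X (n + 1) ω = X n ω + 1 then (1 : ℝ) else 0) | walkFiltration X n]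
        =ᵐ[μ] fun ω => walkF (-(Δ X n ω) / 2))
    {P : (ℕ → ℤ) → Prop} {n : ℕ} (hP : DependsOn P (Iic n)) {θ K : ℝ} (hθ : |θ| ≤ 1)
    (hK : 1 < K) (i : ℕ) :
    ∫ ω, haltedExp P θ K n i (fun m => X m ω) ∂μ ≤ μ.real {ω | P fun m => X m ω} := by
  have hK0 : 0 ≤ K := by linarith
  have hint : ∀ i, Integrable (fun ω => haltedExp P θ K n i (fun m => X m ω)) μ := fun i =>
    integrable_of_dependsOn hmeas (dependsOn_haltedExp hP θ K i) (C := K) fun x =>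
      abs_le.2 ⟨by linarith [(haltedExp_nonneg_le P θ hK0 n i x).1],
        (haltedExp_nonneg_le P θ hK0 n i x).2⟩
  induction i with
  | zero =>
    have hS : MeasurableSet {ω | P fun m => X m ω} :=
      measurableSet_setOfPred.2 (measurable_of_dependsOn hmeas hP)
    rw [← integral_indicator_one hS]
    refine le_of_eq (integral_congr_ae (ae_of_all _ fun ω => ?_))
    have h0 : expSum θ (fun m => X m ω) n 0 = 1 := by simp [expSum, compSum, varSum]
    by_cases hω : P fun m => X m ω
    · rw [indicator_of_mem (by exact hω)]
      simp only [haltedExp]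
      rw [if_pos hω, if_pos, h0, Pi.one_apply]
      intro j hj
      rw [Nat.le_zero.1 hj, h0]
      exact hK
    · rw [indicator_of_notMem (by exact hω)]
      simp only [haltedExp]
      rw [if_neg hω]
  | succ i ih =>
    refine le_trans ?_ ih
    have hF := dependsOn_haltedExpNext hP θ K i true
    have hG := dependsOn_haltedExpNext hP θ K i false
    have hFC := abs_haltedExpNext_le P hθ hK0 n i true
    have hGC := abs_haltedExpNext_le P hθ hK0 n i false
    have hkey := integral_ite_right (μ := μ) hmeas hdrive hF hG hFC hGC
    have hi1 : Integrable (fun ω => if X (n + i + 1) ω = X (n + i) ω + 1 then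
        haltedExpNext P θ K n i true fun m => X m ω else
        haltedExpNext P θ K n i false fun m => X m ω) μ := by
      refine integrable_of_dependsOn hmeas (n := n + i + 1)
        (F := fun x => if x (n + i + 1) = x (n + i) + 1 then
        haltedExpNext P θ K n i true x else haltedExpNext P θ K n i false x)
        (fun x y h => ?_) (C := K * exp 1) fun x => ?_
      · have h' : ∀ m ∈ Iic (n + i), x m = y m := fun m hm =>
          h m (by simp only [mem_Iic] at *; omega)
        simp only
        rw [h (n + i) (by simp), h (n + i + 1) (by simp), hF h', hG h']
      · split_ifs
        · exact hFC x
        · exact hGC x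
    have hi2 : Integrable (fun ω => haltedExpNext P θ K n i true (fun m => X m ω) *
        (1 - sigmoid (pathDelta (fun m => X m ω) (n + i))) +
        haltedExpNext P θ K n i false (fun m => X m ω) *
          sigmoid (pathDelta (fun m => X m ω) (n + i))) μ := by
      refine integrable_of_dependsOn hmeas (n := n + i)
        (F := fun x => haltedExpNext P θ K n i true x * (1 - sigmoid (pathDelta x (n + i))) +
          haltedExpNext P θ K n i false x * sigmoid (pathDelta x (n + i)))
        (fun x y h => ?_) (C := K * exp 1 + K * exp 1) fun x => ?_
      · have := dependsOn_pathDelta (n + i) h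
        simp only at this ⊢
        rw [hF h, hG h, this]
      · have h1 := sigmoid_nonneg (pathDelta x (n + i))
        have h2 := sigmoid_le_one (pathDelta x (n + i))
        refine (abs_add_le _ _).trans (add_le_add ?_ ?_)
        · rw [abs_mul]
          exact (mul_le_of_le_one_right (abs_nonneg _)
            (abs_le.2 ⟨by linarith, by linarith⟩)).trans (hFC x)
        · rw [abs_mul]
          exact (mul_le_of_le_one_right (abs_nonneg _)
            (abs_le.2 ⟨by linarith, by linarith⟩)).trans (hGC x)
    calc _ ≤ _ := integral_mono (hint (i + 1)) hi1 fun ω => ?_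
      _ = _ := hkey
      _ ≤ _ := integral_mono hi2 (hint i) fun ω => haltedExpNext_mean_le P hθ n i _
    have h := haltedExp_succ_le P θ K n i fun m => X m ω
    simp only at h ⊢
    split_ifs with h1
    · rwa [decide_eq_true h1] at h
    · rwa [decide_eq_false h1] at h

/-- Ville's maximal inequality for `expSum`. -/
theorem measure_exists_le_expSum (hmeas : ∀ n, Measurable (X n))
    (hdrive : ∀ n,
      μ[(fun ω => if X (n + 1) ω = X n ω + 1 then (1 : ℝ) else 0) | walkFiltration X n]
        =ᵐ[μ] fun ω => walkF (-(Δ X n ω) / 2))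
    {P : (ℕ → ℤ) → Prop} {n : ℕ} (hP : DependsOn P (Iic n)) {θ K : ℝ} (hθ : |θ| ≤ 1)
    (hK : 1 < K) :
    μ {ω | P (fun m => X m ω) ∧ ∃ i, K ≤ expSum θ (fun m => X m ω) n i} ≤
      ENNReal.ofReal (μ.real {ω | P fun m => X m ω} / K) := by
  have hK0 : 0 < K := by linarith
  have hU : {ω | P (fun m => X m ω) ∧ ∃ i, K ≤ expSum θ (fun m => X m ω) n i} =
      ⋃ i, {ω | P (fun m => X m ω) ∧ ¬ ∀ j ≤ i, expSum θ (fun m => X m ω) n j < K} := by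
    ext ω
    simp only [mem_ofPred_eq, mem_iUnion]
    constructor
    · rintro ⟨h, i, hi⟩
      exact ⟨i, h, fun hc => (hc i le_rfl).not_ge hi⟩
    · rintro ⟨i, h, hi⟩
      push Not at hi
      obtain ⟨j, -, hj⟩ := hi
      exact ⟨h, j, hj⟩
  have hmono : Monotone fun i =>
      {ω | P (fun m => X m ω) ∧ ¬ ∀ j ≤ i, expSum θ (fun m => X m ω) n j < K} :=
    fun a b hab ω ⟨h, hω⟩ => ⟨h, fun hc => hω fun j hj => hc j (hj.trans hab)⟩
  rw [hU, hmono.measure_iUnion]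
  refine iSup_le fun i => ?_
  have hS : MeasurableSet
      {ω | P (fun m => X m ω) ∧ ¬ ∀ j ≤ i, expSum θ (fun m => X m ω) n j < K} := by
    refine measurableSet_setOfPred.2 (measurable_of_dependsOn hmeas
      (F := fun x => P x ∧ ¬ ∀ j ≤ i, expSum θ x n j < K) (n := n + i) fun x y h => ?_)
    have h1 := DependsOn.mono_Iic hP (Nat.le_add_right n i) h
    have h2 := dependsOn_forall_expSum_lt θ K n i h
    simp only at h1 h2 ⊢
    rw [h1, h2]
  rw [← ofReal_measureReal]
  refine ENNReal.ofReal_le_ofReal ?_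
  rw [le_div_iff₀ hK0, ← integral_indicator_one hS, ← integral_mul_const]
  refine le_trans (integral_mono_of_nonneg (ae_of_all _ fun ω => ?_)
    (integrable_of_dependsOn hmeas (dependsOn_haltedExp hP θ K i) (C := K) fun x =>
      abs_le.2 ⟨by linarith [(haltedExp_nonneg_le P θ hK0.le n i x).1],
        (haltedExp_nonneg_le P θ hK0.le n i x).2⟩) (ae_of_all _ fun ω => ?_))
    (integral_haltedExp_le hmeas hdrive hP hθ hK i)
  · exact mul_nonneg (indicator_nonneg (fun _ _ => zero_le_one) _) hK0.le
  · by_cases hω : P (fun m => X m ω) ∧ ¬ ∀ j ≤ i, expSum θ (fun m => X m ω) n j < K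
    · simp only
      rw [indicator_of_mem (by exact hω), haltedExp, if_pos hω.1, if_neg hω.2]
      simp
    · simp only
      rw [indicator_of_notMem (by exact hω), zero_mul]
      exact (haltedExp_nonneg_le P θ hK0.le n i _).1

end

section

variable {Ω : Type*} {X : ℕ → Ω → ℤ} [mΩ : MeasurableSpace Ω] {μ : Measure Ω}
  [IsProbabilityMeasure μ]

theorem measurableSet_of_dependsOn (hmeas : ∀ n, Measurable (X n)) {P : (ℕ → ℤ) → Prop} {n : ℕ}
    (hP : DependsOn P (Iic n)) : MeasurableSet {ω | P fun m => X m ω} :=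
  measurableSet_setOfPred.2 (measurable_of_dependsOn hmeas hP)

theorem measureReal_step (hmeas : ∀ n, Measurable (X n))
    (hdrive : ∀ n,
      μ[(fun ω => if X (n + 1) ω = X n ω + 1 then (1 : ℝ) else 0) | walkFiltration X n]
        =ᵐ[μ] fun ω => walkF (-(Δ X n ω) / 2))
    {F G : (ℕ → ℤ) → Prop} {n : ℕ} (hF : DependsOn F (Iic n)) (hG : DependsOn G (Iic n)) :
    μ.real {ω | (X (n + 1) ω = X n ω + 1 ∧ F fun m => X m ω) ∨
        (X (n + 1) ω ≠ X n ω + 1 ∧ G fun m => X m ω)} =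
      ∫ ω, (indicator {x | F x} 1 (fun m => X m ω) *
          (1 - sigmoid (pathDelta (fun m => X m ω) n)) +
        indicator {x | G x} 1 (fun m => X m ω) * sigmoid (pathDelta (fun m => X m ω) n)) ∂μ := by
  have hind : ∀ {F : (ℕ → ℤ) → Prop}, DependsOn F (Iic n) →
      DependsOn (indicator {x | F x} (1 : (ℕ → ℤ) → ℝ)) (Iic n) := fun {F} hF x y h => by
    have h1 := hF h
    by_cases hx : F x
    · have hy : F y := h1 ▸ hx
      rw [indicator_of_mem (by exact hx), indicator_of_mem (by exact hy)]
      rfl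
    · have hy : ¬ F y := h1 ▸ hx
      rw [indicator_of_notMem (by exact hx), indicator_of_notMem (by exact hy)]
  have hbd : ∀ (F : (ℕ → ℤ) → Prop) x, |indicator {x | F x} (1 : (ℕ → ℤ) → ℝ) x| ≤ 1 :=
    fun F x => by by_cases hx : F x <;> simp [hx]
  rw [← integral_ite_right hmeas hdrive (hind hF) (hind hG) (hbd F) (hbd G),
    ← integral_indicator_one (measurableSet_of_dependsOn hmeas (n := n + 1)
      (P := fun x => (x (n + 1) = x n + 1 ∧ F x) ∨ (x (n + 1) ≠ x n + 1 ∧ G x)) fun x y h => ?_)]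
  · refine integral_congr_ae (ae_of_all _ fun ω => ?_)
    by_cases h1 : X (n + 1) ω = X n ω + 1
    · by_cases h2 : F fun m => X m ω <;> simp [h1, h2, indicator]
    · by_cases h2 : G fun m => X m ω <;> simp [h1, h2, indicator]
  · have h' : ∀ m ∈ Iic n, x m = y m := fun m hm => h m (by simp only [mem_Iic] at *; omega)
    simp only
    rw [h n (by simp), h (n + 1) (by simp), hF h', hG h']

theorem dependsOn_eqOn (w : ℕ → ℤ) (n : ℕ) :
    DependsOn (fun x : ℕ → ℤ => ∀ t ≤ n, x t = w t) (Iic n) := fun x y h =>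
  propext (forall₂_congr fun t ht => by rw [h t ht])

/-- Every nearest-neighbour path is followed up to any given time with positive probability. -/
theorem measureReal_eqOn_pos (hmeas : ∀ n, Measurable (X n)) (hX0 : ∀ᵐ ω ∂μ, X 0 ω = 0)
    (hstep : ∀ n, ∀ᵐ ω ∂μ, |X (n + 1) ω - X n ω| = 1)
    (hdrive : ∀ n,
      μ[(fun ω => if X (n + 1) ω = X n ω + 1 then (1 : ℝ) else 0) | walkFiltration X n]
        =ᵐ[μ] fun ω => walkF (-(Δ X n ω) / 2))
    {w : ℕ → ℤ} (hw0 : w 0 = 0) (hw : ∀ n, |w (n + 1) - w n| = 1) (n : ℕ) :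
    0 < μ.real {ω | ∀ t ≤ n, X t ω = w t} := by
  induction n with
  | zero =>
    have : {ω | ∀ t ≤ 0, X t ω = w t} =ᵐ[μ] univ := by
      refine eventuallyEq_univ.2 ?_
      filter_upwards [hX0] with ω h t ht
      rw [Nat.le_zero.1 ht, h, hw0]
    rw [measureReal_congr this, probReal_univ]
    exact one_pos
  | succ n ih =>
    have hS : {ω | ∀ t ≤ n + 1, X t ω = w t} =ᵐ[μ]
        {ω | (X (n + 1) ω = X n ω + 1 ∧ ((∀ t ≤ n, X t ω = w t) ∧ w (n + 1) = w n + 1)) ∨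
        (X (n + 1) ω ≠ X n ω + 1 ∧ ((∀ t ≤ n, X t ω = w t) ∧ w (n + 1) ≠ w n + 1))} := by
      filter_upwards [hstep n] with ω h
      refine propext ?_
      have key : (∀ t ≤ n, X t ω = w t) → (X (n + 1) ω = w (n + 1) ↔
          (X (n + 1) ω = X n ω + 1 ↔ w (n + 1) = w n + 1)) := fun hA => by
        have h1 := hA n le_rfl
        have h2 := hw n
        rw [abs_eq zero_le_one] at h h2
        omega
      constructor
      · intro hA
        have hA' : ∀ t ≤ n, X t ω = w t := fun t ht => hA t (by omega)
        have := (key hA').1 (hA _ le_rfl)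
        by_cases h1 : X (n + 1) ω = X n ω + 1
        · exact Or.inl ⟨h1, hA', this.1 h1⟩
        · exact Or.inr ⟨h1, hA', fun hc => h1 (this.2 hc)⟩
      · rintro (⟨h1, hA, h2⟩ | ⟨h1, hA, h2⟩) t ht
        · rcases Nat.le_succ_iff.1 ht with h3 | rfl
          · exact hA t h3
          · exact (key hA).2 (iff_of_true h1 h2)
        · rcases Nat.le_succ_iff.1 ht with h3 | rfl
          · exact hA t h3
          · exact (key hA).2 (iff_of_false h1 h2)
    have hd : ∀ Q : Prop, DependsOn (fun x : ℕ → ℤ => (∀ t ≤ n, x t = w t) ∧ Q) (Iic n) :=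
      fun Q x y h => by
        have := dependsOn_eqOn w n h
        simp only at this ⊢
        rw [this]
    have hstep' := measureReal_step (μ := μ) hmeas hdrive (hd (w (n + 1) = w n + 1))
      (hd (w (n + 1) ≠ w n + 1))
    rw [measureReal_congr hS, hstep']
    obtain ⟨c, hc, hcw⟩ : ∃ c : ℝ, 0 < c ∧ c = if w (n + 1) = w n + 1
        then 1 - sigmoid (pathDelta w n) else sigmoid (pathDelta w n) := by
      refine ⟨_, ?_, rfl⟩
      split_ifs
      · linarith [sigmoid_lt_one (pathDelta w n)]
      · exact sigmoid_pos _
    refine lt_of_lt_of_eq (mul_pos ih hc) ?_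
    rw [← integral_indicator_one (measurableSet_of_dependsOn hmeas (dependsOn_eqOn w n)),
      ← integral_mul_const]
    refine integral_congr_ae (ae_of_all _ fun ω => ?_)
    simp only
    by_cases hA : ∀ t ≤ n, X t ω = w t
    · have hδ : pathDelta (fun m => X m ω) n = pathDelta w n := dependsOn_pathDelta n hA
      rw [hδ, hcw, indicator_of_mem (by exact hA)]
      by_cases h1 : w (n + 1) = w n + 1
      · rw [if_pos h1, indicator_of_mem (by exact ⟨hA, h1⟩),
          indicator_of_notMem (by exact fun h => h.2 h1)]
        simp
      · rw [if_neg h1, indicator_of_notMem (by exact fun h => h1 h.2),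
          indicator_of_mem (by exact ⟨hA, h1⟩)]
        simp
    · rw [indicator_of_notMem (by exact hA), indicator_of_notMem (by exact fun h => hA h.1),
        indicator_of_notMem (by exact fun h => hA h.1)]
      simp

theorem measureReal_surprising_le (hmeas : ∀ n, Measurable (X n))
    (hdrive : ∀ n,
      μ[(fun ω => if X (n + 1) ω = X n ω + 1 then (1 : ℝ) else 0) | walkFiltration X n]
        =ᵐ[μ] fun ω => walkF (-(Δ X n ω) / 2))
    {P : (ℕ → ℤ) → Prop} {n k : ℕ} (hP : DependsOn P (Iic n)) (hk : n ≤ k) (T : ℝ) :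
    μ.real {ω | (X (k + 1) ω = X k ω + 1 ∧ (P fun m => X m ω) ∧
          T ≤ pathDelta (fun m => X m ω) k) ∨
        (X (k + 1) ω ≠ X k ω + 1 ∧ (P fun m => X m ω) ∧
          pathDelta (fun m => X m ω) k ≤ -T)} ≤
      2 * exp (-T) * μ.real {ω | P fun m => X m ω} := by
  have hd : ∀ Q : ℝ → Prop, DependsOn (fun x : ℕ → ℤ => P x ∧ Q (pathDelta x k)) (Iic k) :=
    fun Q x y h => by
      have h1 := DependsOn.mono_Iic hP hk h
      have h2 := dependsOn_pathDelta k h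
      simp only at h1 h2 ⊢
      rw [h1, h2]
  have hS := measurableSet_of_dependsOn hmeas hP
  rw [measureReal_step hmeas hdrive (hd fun δ => T ≤ δ) (hd fun δ => δ ≤ -T),
    ← integral_indicator_one hS, ← integral_const_mul]
  refine integral_mono_of_nonneg (ae_of_all _ fun ω => ?_)
    (((integrable_const (1 : ℝ)).indicator hS).const_mul _) (ae_of_all _ fun ω => ?_)
  · have h1 := sigmoid_nonneg (pathDelta (fun m => X m ω) k)
    have h2 := sigmoid_le_one (pathDelta (fun m => X m ω) k)
    exact add_nonneg
      (mul_nonneg (indicator_nonneg (fun _ _ => zero_le_one) _) (by linarith))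
      (mul_nonneg (indicator_nonneg (fun _ _ => zero_le_one) _) h1)
  · simp only
    have hT := exp_pos (-T)
    by_cases hA : P fun m => X m ω
    · rw [indicator_of_mem (s := {ω | P fun m => X m ω}) (by exact hA), Pi.one_apply, mul_one,
        two_mul]
      refine add_le_add ?_ ?_
      · by_cases h1 : T ≤ pathDelta (fun m => X m ω) k
        · rw [indicator_of_mem (by exact ⟨hA, h1⟩), Pi.one_apply, one_mul, ← sigmoid_neg]
          exact (sigmoid_le_exp _).trans (exp_le_exp.2 (by linarith))
        · rw [indicator_of_notMem (by exact fun h => h1 h.2), zero_mul]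
          exact hT.le
      · by_cases h1 : pathDelta (fun m => X m ω) k ≤ -T
        · rw [indicator_of_mem (by exact ⟨hA, h1⟩), Pi.one_apply, one_mul]
          exact (sigmoid_le_exp _).trans (exp_le_exp.2 h1)
        · rw [indicator_of_notMem (by exact fun h => h1 h.2), zero_mul]
          exact hT.le
    · rw [indicator_of_notMem (s := {x | P x ∧ T ≤ pathDelta x k}) (by exact fun h => hA h.1),
        indicator_of_notMem (s := {x | P x ∧ pathDelta x k ≤ -T}) (by exact fun h => hA h.1),
        indicator_of_notMem (s := {ω | P fun m => X m ω}) (by exact hA)]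
      simp

/-- Surprising steps after the comb phase are unlikely. -/
theorem measure_exists_surprising_le (hmeas : ∀ n, Measurable (X n))
    (hdrive : ∀ n,
      μ[(fun ω => if X (n + 1) ω = X n ω + 1 then (1 : ℝ) else 0) | walkFiltration X n]
        =ᵐ[μ] fun ω => walkF (-(Δ X n ω) / 2))
    {P : (ℕ → ℤ) → Prop} {N : ℕ} (hP : DependsOn P (Iic (combTime N))) (hN : 100000 ≤ N) :
    μ {ω | (P fun m => X m ω) ∧ ∃ k ≥ combTime N,
        (X (k + 1) ω = X k ω + 1 ∧ 2 * log k ≤ pathDelta (fun m => X m ω) k) ∨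
        (X (k + 1) ω ≠ X k ω + 1 ∧ pathDelta (fun m => X m ω) k ≤ -(2 * log k))} ≤
      ENNReal.ofReal (μ.real {ω | P fun m => X m ω} / 8) := by
  set a := μ.real {ω | P fun m => X m ω} with ha
  have ha0 : 0 ≤ a := measureReal_nonneg
  set E : ℕ → Set Ω := fun i =>
    {ω | (X (combTime N + i + 1) ω = X (combTime N + i) ω + 1 ∧ (P fun m => X m ω) ∧
        2 * log (combTime N + i : ℕ) ≤ pathDelta (fun m => X m ω) (combTime N + i)) ∨
      (X (combTime N + i + 1) ω ≠ X (combTime N + i) ω + 1 ∧ (P fun m => X m ω) ∧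
        pathDelta (fun m => X m ω) (combTime N + i) ≤ -(2 * log (combTime N + i : ℕ)))} with hE
  have hEle : ∀ i, μ (E i) ≤ ENNReal.ofReal ((frontErr N (i + 1) - frontErr N i) * a) := fun i => by
    rw [← ofReal_measureReal]
    refine ENNReal.ofReal_le_ofReal ((measureReal_surprising_le hmeas hdrive hP
      (Nat.le_add_right _ i) _).trans (mul_le_mul_of_nonneg_right ?_ ha0))
    linarith [frontErr_succ (by omega : 1 ≤ N) i]
  have hsub : {ω | (P fun m => X m ω) ∧ ∃ k ≥ combTime N,
        (X (k + 1) ω = X k ω + 1 ∧ 2 * log k ≤ pathDelta (fun m => X m ω) k) ∨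
        (X (k + 1) ω ≠ X k ω + 1 ∧ pathDelta (fun m => X m ω) k ≤ -(2 * log k))} ⊆ ⋃ i, E i := by
    rintro ω ⟨h, k, hk, h'⟩
    obtain ⟨i, rfl⟩ := Nat.exists_eq_add_of_le hk
    refine mem_iUnion.2 ⟨i, ?_⟩
    rcases h' with ⟨h1, h2⟩ | ⟨h1, h2⟩
    · exact Or.inl ⟨h1, h, h2⟩
    · exact Or.inr ⟨h1, h, h2⟩
  refine (measure_mono hsub).trans ((measure_iUnion_le _).trans
    (ENNReal.tsum_le_of_sum_range_le fun n => (Finset.sum_le_sum fun i _ => hEle i).trans ?_))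
  have hmono : ∀ i, 0 ≤ frontErr N (i + 1) - frontErr N i := fun i => by
    linarith [frontErr_succ (by omega : 1 ≤ N) i, exp_pos (-(2 * log (combTime N + i : ℕ)))]
  rw [← ENNReal.ofReal_sum_of_nonneg fun i _ => mul_nonneg (hmono i) ha0, ← Finset.sum_mul,
    Finset.sum_range_sub]
  refine ENNReal.ofReal_le_ofReal ?_
  have hc : (100000 : ℝ) ≤ combTime N := by
    have : 100000 ≤ combTime N := by
      unfold combTime
      nlinarith
    exact_mod_cast this
  have h0 : frontErr N 0 = 0 := by simp [frontErr]
  have h1 : frontErr N n ≤ 1 / 8 := by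
    have h2 : 0 ≤ 2 / ((combTime N : ℝ) + n - 1) :=
      div_nonneg two_pos.le (by linarith [(Nat.cast_nonneg n : (0 : ℝ) ≤ n)])
    have h3 : 2 / ((combTime N : ℝ) - 1) ≤ 1 / 8 := by
      rw [div_le_div_iff₀ (by linarith) (by norm_num)]
      linarith
    unfold frontErr
    linarith
  rw [h0, sub_zero]
  nlinarith

theorem mul_compSum_lt_of_expSum_lt {θ K : ℝ} {x : ℕ → ℤ} {n i : ℕ} (h : expSum θ x n i < K) :
    θ * compSum x n i < θ ^ 2 * varSum x n i + log K := by
  have := (lt_log_iff_exp_lt ((expSum_pos θ x n i).trans h)).2 h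
  linarith

theorem ae_exists_expSum_lt (hmeas : ∀ n, Measurable (X n))
    (hdrive : ∀ n,
      μ[(fun ω => if X (n + 1) ω = X n ω + 1 then (1 : ℝ) else 0) | walkFiltration X n]
        =ᵐ[μ] fun ω => walkF (-(Δ X n ω) / 2))
    (n : ℕ) {θ : ℝ} (hθ : |θ| ≤ 1) :
    ∀ᵐ ω ∂μ, ∃ K : ℝ, ∀ i, expSum θ (fun m => X m ω) n i < K := by
  have h : ∀ j : ℕ, μ {ω | ¬ ∃ K : ℝ, ∀ i, expSum θ (fun m => X m ω) n i < K} ≤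
      ENNReal.ofReal (1 / ((j : ℝ) + 2)) := fun j => by
    have hK : (1 : ℝ) < (j : ℝ) + 2 := by linarith [(Nat.cast_nonneg j : (0 : ℝ) ≤ j)]
    have h1 := measure_exists_le_expSum hmeas hdrive (P := fun _ => True) (n := n)
      (fun _ _ _ => rfl) hθ hK
    have h2 : μ.real {_ω : Ω | True} = 1 := by
      rw [show {_ω : Ω | True} = univ from eq_univ_of_forall fun _ => trivial, probReal_univ]
    rw [h2] at h1
    refine le_trans (measure_mono fun ω hω => ?_) h1
    refine ⟨trivial, ?_⟩
    by_contra! hc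
    exact hω ⟨_, hc⟩
  refine ae_iff.2 (nonpos_iff_eq_zero.1 ?_)
  refine ge_of_tendsto' (x := (atTop : Filter ℕ)) ?_ h
  rw [← ENNReal.ofReal_zero]
  refine ENNReal.tendsto_ofReal ?_
  have h3 : Tendsto (fun j : ℕ => (j : ℝ) + 2) atTop atTop :=
    tendsto_atTop_add_const_right _ _ tendsto_natCast_atTop_atTop
  simp only [one_div]
  exact h3.inv_tendsto_atTop

theorem ae_abs_compSum_le_mul (hmeas : ∀ n, Measurable (X n))
    (hdrive : ∀ n,
      μ[(fun ω => if X (n + 1) ω = X n ω + 1 then (1 : ℝ) else 0) | walkFiltration X n]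
        =ᵐ[μ] fun ω => walkF (-(Δ X n ω) / 2))
    (n : ℕ) :
    ∀ᵐ ω ∂μ, ∀ ε > 0, ∃ K, ∀ i, |compSum (fun m => X m ω) n i| ≤
      ε * varSum (fun m => X m ω) n i + K := by
  have hθ : ∀ j : ℕ, |1 / ((j : ℝ) + 1)| ≤ 1 := fun j => by
    have : (0 : ℝ) ≤ j := Nat.cast_nonneg j
    rw [abs_of_nonneg (by positivity)]
    exact div_le_one_of_le₀ (by linarith) (by linarith)
  have h1 := ae_all_iff.2 fun j : ℕ => ae_exists_expSum_lt (μ := μ) hmeas hdrive n (hθ j)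
  have h2 := ae_all_iff.2 fun j : ℕ => ae_exists_expSum_lt (μ := μ) hmeas hdrive n
    (θ := -(1 / ((j : ℝ) + 1))) (by rw [abs_neg]; exact hθ j)
  filter_upwards [h1, h2] with ω h3 h4 ε hε
  obtain ⟨j, hj⟩ := exists_nat_one_div_lt hε
  obtain ⟨K, hK⟩ := h3 j
  obtain ⟨L, hL⟩ := h4 j
  set θ := 1 / ((j : ℝ) + 1) with hθd
  have hθ0 : 0 < θ := by positivity
  refine ⟨(|log K| + |log L|) / θ, fun i => ?_⟩
  have h5 := mul_compSum_lt_of_expSum_lt (hK i)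
  have h6 := mul_compSum_lt_of_expSum_lt (hL i)
  have hv : 0 ≤ varSum (fun m => X m ω) n i := Finset.sum_nonneg fun m _ =>
    mul_nonneg (sigmoid_nonneg _) (by
      linarith [sigmoid_le_one (pathDelta (fun m => X m ω) (n + m))])
  have h7 := mul_le_mul_of_nonneg_right hj.le hv
  have h8 := mul_le_mul_of_nonneg_left h7 hθ0.le
  have h9 : (ε * varSum (fun m => X m ω) n i + (|log K| + |log L|) / θ) * θ =
      θ * (ε * varSum (fun m => X m ω) n i) + (|log K| + |log L|) := by
    field_simp
  refine le_of_mul_le_mul_right ?_ hθ0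
  rw [h9, ← abs_of_pos hθ0, ← abs_mul, abs_of_pos hθ0]
  refine abs_le.2 ⟨?_, ?_⟩ <;>
    nlinarith [le_abs_self (log K), le_abs_self (log L), abs_nonneg (log K), abs_nonneg (log L)]

theorem abs_compSum_le_of_expSum_lt {x : ℕ → ℤ} {n i : ℕ} (h1 : expSum (1 / 32) x n i < 8)
    (h2 : expSum (-(1 / 32)) x n i < 8) : |compSum x n i| ≤ varSum x n i / 32 + 96 := by
  have h8 : log 8 ≤ 3 := by
    rw [show (8 : ℝ) = 2 ^ 3 by norm_num, log_pow]
    have := log_two_lt_d9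
    norm_num
    linarith
  have h3 := mul_compSum_lt_of_expSum_lt h1
  have h4 := mul_compSum_lt_of_expSum_lt h2
  refine abs_le.2 ⟨?_, ?_⟩ <;> linarith

theorem measure_goodPath_pos (hmeas : ∀ n, Measurable (X n)) (hX0 : ∀ᵐ ω ∂μ, X 0 ω = 0)
    (hstep : ∀ n, ∀ᵐ ω ∂μ, |X (n + 1) ω - X n ω| = 1)
    (hdrive : ∀ n,
      μ[(fun ω => if X (n + 1) ω = X n ω + 1 then (1 : ℝ) else 0) | walkFiltration X n]
        =ᵐ[μ] fun ω => walkF (-(Δ X n ω) / 2))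
    {N : ℕ} (hN : 100000 ≤ N) : 0 < μ {ω | GoodPath (fun m => X m ω) N} := by
  have hP := dependsOn_eqOn (combPath N) (combTime N)
  have hpos := measureReal_eqOn_pos hmeas hX0 hstep hdrive (combPath_zero N)
    (abs_combPath_succ_sub N) (combTime N)
  have h32 : |(1 / 32 : ℝ)| ≤ 1 := by rw [abs_of_nonneg] <;> norm_num
  have hB1 := measure_exists_le_expSum hmeas hdrive hP h32 (by norm_num : (1 : ℝ) < 8)
  have hB2 := measure_exists_le_expSum hmeas hdrive hP (by rwa [abs_neg])
    (by norm_num : (1 : ℝ) < 8)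
  have hB3 := measure_exists_surprising_le hmeas hdrive hP hN
  set a := μ.real {ω | ∀ t ≤ combTime N, X t ω = combPath N t}
  set B1 := {ω | (∀ t ≤ combTime N, X t ω = combPath N t) ∧
    ∃ i, 8 ≤ expSum (1 / 32) (fun m => X m ω) (combTime N) i}
  set B2 := {ω | (∀ t ≤ combTime N, X t ω = combPath N t) ∧
    ∃ i, 8 ≤ expSum (-(1 / 32)) (fun m => X m ω) (combTime N) i}
  set B3 := {ω | (∀ t ≤ combTime N, X t ω = combPath N t) ∧ ∃ k ≥ combTime N,
        (X (k + 1) ω = X k ω + 1 ∧ 2 * log k ≤ pathDelta (fun m => X m ω) k) ∨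
        (X (k + 1) ω ≠ X k ω + 1 ∧ pathDelta (fun m => X m ω) k ≤ -(2 * log k))}
  by_contra hc
  have hG : μ {ω | GoodPath (fun m => X m ω) N} = 0 := not_not.1 fun h => hc (pos_iff_ne_zero.2 h)
  have hsub : {ω | ∀ t ≤ combTime N, X t ω = combPath N t} ≤ᵐ[μ]
      ({ω | GoodPath (fun m => X m ω) N} ∪ (B1 ∪ B2 ∪ B3) : Set Ω) := by
    filter_upwards [ae_all_iff.2 hstep, ae_abs_compSum_le_mul hmeas hdrive (combTime N)]
      with ω h1 h2 hA
    by_cases hB : ω ∈ B1 ∪ B2 ∪ B3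
    · exact Or.inr hB
    · simp only [mem_union, not_or] at hB
      obtain ⟨⟨hn1, hn2⟩, hn3⟩ := hB
      refine Or.inl ⟨h1, hA, fun k hk => ⟨fun hδ hr => hn3 ⟨hA, k, hk, Or.inl ⟨hr, hδ⟩⟩,
        fun hδ => ?_⟩, fun i => abs_compSum_le_of_expSum_lt ?_ ?_, h2⟩
      · by_contra hr
        exact hn3 ⟨hA, k, hk, Or.inr ⟨hr, hδ⟩⟩
      · exact lt_of_not_ge fun h => hn1 ⟨hA, i, h⟩
      · exact lt_of_not_ge fun h => hn2 ⟨hA, i, h⟩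
  have hle : ENNReal.ofReal a ≤ ENNReal.ofReal (a / 8 + a / 8 + a / 8) := by
    rw [ENNReal.ofReal_add (by positivity) (by positivity),
      ENNReal.ofReal_add (by positivity) (by positivity)]
    calc ENNReal.ofReal a = _ := ofReal_measureReal
      _ ≤ _ := measure_mono_ae hsub
      _ ≤ _ := measure_union_le _ _
      _ ≤ 0 + _ := add_le_add hG.le ((measure_union_le _ _).trans
        (add_le_add ((measure_union_le _ _).trans (add_le_add hB1 hB2)) hB3))
      _ = _ := zero_add _
  have := (ENNReal.ofReal_le_ofReal_iff (by positivity)).1 hle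
  linarith

end

/-- for the walk driven by `-Δ/2`, with positive probability every
nonnegative site `x` is hit, and the hitting times satisfy `τ_x / x² → 1/2`. -/
theorem stmt15 {Ω : Type*} [MeasurableSpace Ω] (μ : Measure Ω) [IsProbabilityMeasure μ]
    (X : ℕ → Ω → ℤ) (hmeas : ∀ n, Measurable (X n))
    (hX0 : ∀ᵐ ω ∂μ, X 0 ω = 0)
    (hstep : ∀ n, ∀ᵐ ω ∂μ, |X (n + 1) ω - X n ω| = 1)
    (hdrive : ∀ n,
      μ[(fun ω => if X (n + 1) ω = X n ω + 1 then (1 : ℝ) else 0) | walkFiltration X n]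
        =ᵐ[μ] fun ω => walkF (-(Δ X n ω) / 2)) :
    0 < μ {ω | (∀ x : ℕ, ∃ n : ℕ, X n ω = (x : ℤ)) ∧
        Tendsto (fun x : ℕ => ((sInf {n : ℕ | X n ω = (x : ℤ)} : ℕ) : ℝ) / (x : ℝ) ^ 2)
          atTop (nhds (1 / 2))} := by
  obtain ⟨N, hN⟩ := exists_isLarge
  exact (measure_goodPath_pos hmeas hX0 hstep hdrive hN.1).trans_le
    (measure_mono fun ω hω => GoodPath.tendsto_hitting hω hN)
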